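/- arXiv:1805.05529 — 3 statements merged into one kernel-verified Lean document; each statement's English description precedes it below -/
import Mathlib

section
/- Let N be a positive integer and let ν_1, …, ν_N > 0. Let X be a random N×N real matrix whose rows are independent, with row l distributed according to the beta type I density π^{-N/2} (Γ((ν_l+N)/2)/Γ(ν_l/2)) (1−|x|²)^{ν_l/2−1} supported on the open unit ball of ℝ^N. Then for every real α > −1/2 the expectation E[|det X|^{2α}] is finite and equals ∏_{l=1}^N [Γ((N−l+1)/2 + α)/Γ((N−l+1)/2)] · [Γ((N+ν_l)/2)/Γ((N+ν_l)/2 + α)]. -/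
open MeasureTheory Real

/-- The distribution on `ℝ^N` of a row with beta type I density
`π^{-N/2} (Γ((ν+N)/2)/Γ(ν/2)) (1-|x|²)^{ν/2-1}` supported on the open unit ball. -/
noncomputable def betaIRowMeasure (N : ℕ) (ν : ℝ) : Measure (Fin N → ℝ) :=
  volume.withDensity fun x =>
    ENNReal.ofReal (if ∑ j, x j ^ 2 < 1 then
      π ^ (-(N : ℝ) / 2) * (Real.Gamma ((ν + N) / 2) / Real.Gamma (ν / 2)) *
        (1 - ∑ j, x j ^ 2) ^ (ν / 2 - 1)
    else 0)

open Set

open scoped ENNReal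

/-- Gamma integral, as a lower Lebesgue integral. -/
theorem lintegral_rpow_mul_exp_neg {a : ℝ} (ha : 0 < a) :
    ∫⁻ t in Ioi (0 : ℝ), ENNReal.ofReal (t ^ (a - 1)) * ENNReal.ofReal (exp (-t)) =
      ENNReal.ofReal (Real.Gamma a) := by
  rw [Real.Gamma_eq_integral ha, ofReal_integral_eq_lintegral_ofReal
    (Real.GammaIntegral_convergent ha)]
  · refine setLIntegral_congr_fun measurableSet_Ioi fun t ht => ?_
    rw [mul_comm, ENNReal.ofReal_mul (exp_pos _).le]
  · filter_upwards [ae_restrict_mem measurableSet_Ioi] with t ht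
    have : 0 < t := ht
    positivity

/-- Beta integral, as a lower Lebesgue integral. -/
theorem lintegral_rpow_mul_one_sub_rpow {a b : ℝ} (ha : 0 < a) (hb : 0 < b) :
    ∫⁻ t in Ioi (0 : ℝ), ENNReal.ofReal (t ^ (a - 1)) *
        ENNReal.ofReal (if t < 1 then (1 - t) ^ (b - 1) else 0) =
      ENNReal.ofReal (Real.Gamma a * Real.Gamma b / Real.Gamma (a + b)) := by
  have hB : 0 < ProbabilityTheory.beta a b := ProbabilityTheory.beta_pos ha hb
  have key : ∀ t : ℝ, (Ioi (0 : ℝ)).indicator (fun t => ENNReal.ofReal (t ^ (a - 1)) *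
        ENNReal.ofReal (if t < 1 then (1 - t) ^ (b - 1) else 0)) t =
      ENNReal.ofReal (ProbabilityTheory.beta a b) * ProbabilityTheory.betaPDF a b t := by
    intro t
    rw [ProbabilityTheory.betaPDF_eq, ← ENNReal.ofReal_mul hB.le]
    by_cases h0 : 0 < t
    · rw [indicator_of_mem (mem_Ioi.2 h0), ← ENNReal.ofReal_mul (rpow_nonneg h0.le _)]
      by_cases h1 : t < 1
      · simp only [h0, h1, and_self, if_true]
        congr 1
        field_simp
      · simp [h1]
    · simp [h0]
  rw [← lintegral_indicator measurableSet_Ioi, lintegral_congr key,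
    lintegral_const_mul' _ _ ENNReal.ofReal_ne_top,
    ProbabilityTheory.lintegral_betaPDF_eq_one ha hb, mul_one, ProbabilityTheory.beta]

/-- Substitution `t = r ^ 2` on the positive half-line. -/
theorem lintegral_Ioi_comp_sq (u : ℝ → ℝ≥0∞) :
    ∫⁻ r in Ioi (0 : ℝ), ENNReal.ofReal (2 * r) * u (r ^ 2) = ∫⁻ t in Ioi (0 : ℝ), u t := by
  have himg : (fun r : ℝ => r ^ 2) '' Ioi 0 = Ioi 0 := by
    ext t
    constructor
    · rintro ⟨r, hr, rfl⟩
      exact pow_pos (mem_Ioi.1 hr) 2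
    · intro ht
      exact ⟨√t, sqrt_pos.2 ht, sq_sqrt (le_of_lt ht)⟩
  have hsub := lintegral_image_eq_lintegral_deriv_mul_of_monotoneOn (f := fun r : ℝ => r ^ 2)
    (f' := fun r => 2 * r) measurableSet_Ioi (s := Ioi 0) ?_ ?_ u
  · rw [← hsub, himg]
  · intro r _
    simpa using (hasDerivAt_pow 2 r).hasDerivWithinAt
  · intro r hr s _ hrs
    exact pow_le_pow_left₀ (le_of_lt hr) hrs 2

/-- Polar integration of a positively homogeneous function against a radial one: the angular part
contributes a constant independent of the radial function. -/
theorem exists_lintegral_homogeneous_mul_radial {n : ℕ} (hn : 0 < n) (α : ℝ)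
    {g : (Fin n → ℝ) → ℝ≥0∞} (hg : Measurable g)
    (hhom : ∀ r : ℝ, 0 < r → ∀ x, g (r • x) = ENNReal.ofReal (r ^ (2 * α)) * g x) :
    ∃ S : ℝ≥0∞, ∀ φ : ℝ → ℝ≥0∞, Measurable φ →
      ∫⁻ x, g x * φ (∑ j, x j ^ 2) =
        S * ∫⁻ t in Ioi (0 : ℝ), ENNReal.ofReal (t ^ ((n : ℝ) / 2 + α - 1)) * φ t := by
  have : Nonempty (Fin n) := ⟨⟨0, hn⟩⟩
  refine ⟨(∫⁻ u, g (WithLp.ofLp u.1) ∂(volume : Measure (EuclideanSpace ℝ (Fin n))).toSphere) *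
    ENNReal.ofReal (1 / 2), fun φ hφ => ?_⟩
  have hmp := PiLp.volume_preserving_ofLp (Fin n)
  have hofLp : Measurable (WithLp.ofLp : EuclideanSpace ℝ (Fin n) → Fin n → ℝ) := hmp.measurable
  set F : EuclideanSpace ℝ (Fin n) → ℝ≥0∞ := fun x => g (WithLp.ofLp x) * φ (‖x‖ ^ 2) with hF
  have hFm : Measurable F :=
    (hg.comp hofLp).mul (hφ.comp (by fun_prop))
  set h : Ioi (0 : ℝ) → ℝ≥0∞ := fun r => ENNReal.ofReal (r.1 ^ (2 * α)) * φ (r.1 ^ 2) with hh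
  have hhm : Measurable h := by
    have : Measurable fun r : ℝ => ENNReal.ofReal (r ^ (2 * α)) * φ (r ^ 2) :=
      Measurable.mul (by fun_prop) (hφ.comp (by fun_prop))
    exact this.comp measurable_subtype_coe
  calc ∫⁻ x, g x * φ (∑ j, x j ^ 2)
      = ∫⁻ x : EuclideanSpace ℝ (Fin n), F x := by
        have hm : Measurable fun x : Fin n → ℝ => g x * φ (∑ j, x j ^ 2) :=
          hg.mul (hφ.comp (by fun_prop))
        rw [← hmp.lintegral_comp hm]
        simp [hF, EuclideanSpace.norm_sq_eq]
    _ = ∫⁻ x : ({(0 : EuclideanSpace ℝ (Fin n))}ᶜ : Set (EuclideanSpace ℝ (Fin n))),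
          F x.1 ∂(volume.comap Subtype.val) := by
        rw [lintegral_subtype_comap (measurableSet_singleton _).compl F,
          restrict_compl_singleton]
    _ = ∫⁻ p, F (p.2.1 • p.1.1)
          ∂((volume : Measure (EuclideanSpace ℝ (Fin n))).toSphere.prod
            (Measure.volumeIoiPow (Module.finrank ℝ (EuclideanSpace ℝ (Fin n)) - 1))) := by
        have hm : Measurable fun p : Metric.sphere (0 : EuclideanSpace ℝ (Fin n)) 1 × Ioi (0 : ℝ) =>
            F (p.2.1 • p.1.1) := hFm.comp (by fun_prop)
        rw [← (volume : Measure (EuclideanSpace ℝ (Fin n))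
          ).measurePreserving_homeomorphUnitSphereProd.lintegral_comp hm]
        refine lintegral_congr fun x => ?_
        congr 1
        have hx : ‖x.1‖ ≠ 0 := norm_ne_zero_iff.2 x.2
        simp [smul_smul, mul_inv_cancel₀ hx]
    _ = ∫⁻ p : Metric.sphere (0 : EuclideanSpace ℝ (Fin n)) 1 × Ioi (0 : ℝ),
          g (WithLp.ofLp p.1.1) * h p.2
          ∂((volume : Measure (EuclideanSpace ℝ (Fin n))).toSphere.prod
            (Measure.volumeIoiPow (Module.finrank ℝ (EuclideanSpace ℝ (Fin n)) - 1))) := by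
        refine lintegral_congr fun p => ?_
        have hp : 0 < p.2.1 := p.2.2
        have hu : ‖p.1.1‖ = 1 := by simp
        simp only [hF, hh, WithLp.ofLp_smul, hhom _ hp, norm_smul, hu, mul_one, norm_eq_abs,
          sq_abs]
        ring
    _ = (∫⁻ u, g (WithLp.ofLp u.1) ∂(volume : Measure (EuclideanSpace ℝ (Fin n))).toSphere) *
          ∫⁻ r, h r ∂(Measure.volumeIoiPow (Module.finrank ℝ (EuclideanSpace ℝ (Fin n)) - 1)) :=
        lintegral_prod_mul ((hg.comp hofLp).comp measurable_subtype_coe).aemeasurable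
          hhm.aemeasurable
    _ = _ := by
        rw [mul_assoc, Measure.volumeIoiPow, lintegral_withDensity_eq_lintegral_mul _
          (by fun_prop) hhm, ← lintegral_const_mul' _ _ ENNReal.ofReal_ne_top,
          ← lintegral_Ioi_comp_sq]
        congr 1
        refine (lintegral_subtype_comap measurableSet_Ioi fun r : ℝ =>
          ENNReal.ofReal (r ^ (Module.finrank ℝ (EuclideanSpace ℝ (Fin n)) - 1)) *
            (ENNReal.ofReal (r ^ (2 * α)) * φ (r ^ 2))).trans ?_
        refine setLIntegral_congr_fun measurableSet_Ioi fun r (hr : 0 < r) => ?_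
        simp only [← mul_assoc]
        rw [← ENNReal.ofReal_mul (by positivity), ← ENNReal.ofReal_mul (by positivity),
          ← ENNReal.ofReal_mul (by positivity)]
        congr 2
        rw [finrank_euclideanSpace_fin, ← rpow_natCast r (n - 1), Nat.cast_sub hn,
          ← rpow_add hr, ← rpow_natCast r 2, ← rpow_mul hr.le]
        rw [mul_one_div, mul_div_cancel_left₀ _ two_ne_zero]
        nth_rewrite 2 [← rpow_one r]
        rw [← rpow_add hr]
        congr 1
        push_cast
        ring

/-- The Gaussian distribution on `ℝ^n` with density `π^{-n/2} exp(-|x|²)`. -/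
noncomputable def gaussRowMeasure (n : ℕ) : Measure (Fin n → ℝ) :=
  volume.withDensity fun x =>
    ENNReal.ofReal (π ^ (-(n : ℝ) / 2)) * ENNReal.ofReal (exp (-∑ j, x j ^ 2))

instance (n : ℕ) : SigmaFinite (gaussRowMeasure n) :=
  SigmaFinite.withDensity_of_ne_top'
    fun _ => ENNReal.mul_ne_top ENNReal.ofReal_ne_top ENNReal.ofReal_ne_top

instance (n : ℕ) (ν : ℝ) : SigmaFinite (betaIRowMeasure n ν) := by
  unfold betaIRowMeasure
  infer_instance

theorem lintegral_gaussRowMeasure {n : ℕ} {g : (Fin n → ℝ) → ℝ≥0∞} (hg : Measurable g) :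
    ∫⁻ x, g x ∂gaussRowMeasure n = ENNReal.ofReal (π ^ (-(n : ℝ) / 2)) *
      ∫⁻ x, g x * ENNReal.ofReal (exp (-∑ j, x j ^ 2)) := by
  rw [gaussRowMeasure, lintegral_withDensity_eq_lintegral_mul _ (by fun_prop) hg,
    ← lintegral_const_mul' _ _ ENNReal.ofReal_ne_top]
  refine lintegral_congr fun x => ?_
  simp only [Pi.mul_apply]
  ring

/-- A function that is positively homogeneous of degree `2 * α` has proportional expectations under
the beta type I and the Gaussian row distributions. -/
theorem lintegral_betaIRowMeasure_eq {n : ℕ} (hn : 0 < n) {ν α : ℝ} (hν : 0 < ν)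
    (hα : -(1 / 2 : ℝ) < α) {g : (Fin n → ℝ) → ℝ≥0∞} (hg : Measurable g)
    (hhom : ∀ r : ℝ, 0 < r → ∀ x, g (r • x) = ENNReal.ofReal (r ^ (2 * α)) * g x) :
    ∫⁻ x, g x ∂betaIRowMeasure n ν =
      ENNReal.ofReal (Real.Gamma (((n : ℝ) + ν) / 2) / Real.Gamma (((n : ℝ) + ν) / 2 + α)) *
        ∫⁻ x, g x ∂gaussRowMeasure n := by
  obtain ⟨S, hS⟩ := exists_lintegral_homogeneous_mul_radial hn α hg hhom
  have hn' : (1 : ℝ) ≤ n := by exact_mod_cast hn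
  have ha : 0 < (n : ℝ) / 2 + α := by linarith
  have hK : 0 ≤ π ^ (-(n : ℝ) / 2) * (Real.Gamma ((ν + n) / 2) / Real.Gamma (ν / 2)) := by
    have := Real.Gamma_pos_of_pos (show 0 < (ν + n) / 2 by positivity)
    have := Real.Gamma_pos_of_pos (show 0 < ν / 2 by positivity)
    positivity
  have hφm : Measurable fun t : ℝ =>
      ENNReal.ofReal (if t < 1 then (1 - t) ^ (ν / 2 - 1) else 0) :=
    (Measurable.ite measurableSet_Iio (by fun_prop) (by fun_prop)).ennreal_ofReal
  have hβ : ∫⁻ x, g x ∂betaIRowMeasure n ν =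
      ENNReal.ofReal (π ^ (-(n : ℝ) / 2) * (Real.Gamma ((ν + n) / 2) / Real.Gamma (ν / 2))) *
        ∫⁻ x, g x * ENNReal.ofReal
          (if ∑ j, x j ^ 2 < 1 then (1 - ∑ j, x j ^ 2) ^ (ν / 2 - 1) else 0) := by
    have hd : (fun x : Fin n → ℝ => ENNReal.ofReal (if ∑ j, x j ^ 2 < 1 then
          π ^ (-(n : ℝ) / 2) * (Real.Gamma ((ν + n) / 2) / Real.Gamma (ν / 2)) *
            (1 - ∑ j, x j ^ 2) ^ (ν / 2 - 1) else 0)) = fun x =>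
        ENNReal.ofReal (π ^ (-(n : ℝ) / 2) * (Real.Gamma ((ν + n) / 2) / Real.Gamma (ν / 2))) *
          ENNReal.ofReal (if ∑ j, x j ^ 2 < 1 then (1 - ∑ j, x j ^ 2) ^ (ν / 2 - 1) else 0) := by
      funext x
      rw [← ENNReal.ofReal_mul hK, mul_ite, mul_zero]
    have hm : Measurable fun x : Fin n → ℝ =>
        ENNReal.ofReal (if ∑ j, x j ^ 2 < 1 then (1 - ∑ j, x j ^ 2) ^ (ν / 2 - 1) else 0) :=
      hφm.comp (by fun_prop : Measurable fun x : Fin n → ℝ => ∑ j, x j ^ 2)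
    rw [betaIRowMeasure, hd, lintegral_withDensity_eq_lintegral_mul _ (hm.const_mul _) hg,
      ← lintegral_const_mul' _ _ ENNReal.ofReal_ne_top]
    refine lintegral_congr fun x => ?_
    simp only [Pi.mul_apply]
    ring
  rw [hβ, hS _ hφm, lintegral_rpow_mul_one_sub_rpow ha (half_pos hν),
    lintegral_gaussRowMeasure hg, hS (fun t => ENNReal.ofReal (exp (-t))) (by fun_prop),
    lintegral_rpow_mul_exp_neg ha, mul_left_comm, mul_left_comm _ S, mul_left_comm _ S]
  have h1 := Real.Gamma_pos_of_pos ha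
  have h2 := Real.Gamma_pos_of_pos (show 0 < ν / 2 by positivity)
  have h3 := Real.Gamma_pos_of_pos (show 0 < ((n : ℝ) + ν) / 2 by positivity)
  have h4 := Real.Gamma_pos_of_pos (show 0 < ((n : ℝ) + ν) / 2 + α by linarith)
  have e1 : (n : ℝ) / 2 + α + ν / 2 = ((n : ℝ) + ν) / 2 + α := by ring
  rw [← ENNReal.ofReal_mul hK, ← ENNReal.ofReal_mul (by positivity),
    ← ENNReal.ofReal_mul (by positivity), e1, add_comm ν]
  congr 2
  field_simp

theorem lintegral_pi_fin_succ {m : ℕ} {X : Type*} [MeasurableSpace X]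
    (μ : Fin (m + 1) → Measure X) [∀ i, SigmaFinite (μ i)]
    {f : (Fin (m + 1) → X) → ℝ≥0∞} (hf : Measurable f) :
    ∫⁻ M, f M ∂Measure.pi μ =
      ∫⁻ x, ∫⁻ y, f (Fin.cons x y) ∂(Measure.pi fun i => μ (Fin.succ i)) ∂μ 0 := by
  have hmp := (measurePreserving_piFinSuccAbove μ 0).symm
  rw [← hmp.lintegral_comp hf]
  refine (lintegral_prod _ (hf.comp hmp.measurable).aemeasurable).trans ?_
  simp [MeasurableEquiv.piFinSuccAbove, Fin.insertNthEquiv]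

theorem measurable_fin_cons {m : ℕ} {X : Type*} [MeasurableSpace X] :
    Measurable fun p : X × (Fin m → X) => (Fin.cons p.1 p.2 : Fin (m + 1) → X) := by
  refine measurable_pi_iff.2 fun i => ?_
  cases i using Fin.cases with
  | zero => simpa using measurable_fst
  | succ i => simpa [Function.comp_def] using (measurable_pi_apply i).comp measurable_snd

/-- Factors relating integrals of homogeneous functions multiply over independent rows. -/
theorem lintegral_pi_eq_prod_mul {n m : ℕ} (α : ℝ) (μ ρ : Fin m → Measure (Fin n → ℝ))
    [∀ i, SigmaFinite (μ i)] [∀ i, SigmaFinite (ρ i)] (c : Fin m → ℝ≥0∞) (hc : ∀ i, c i ≠ ∞)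
    (h : ∀ i, ∀ g : (Fin n → ℝ) → ℝ≥0∞, Measurable g →
      (∀ r : ℝ, 0 < r → ∀ x, g (r • x) = ENNReal.ofReal (r ^ (2 * α)) * g x) →
      ∫⁻ x, g x ∂μ i = c i * ∫⁻ x, g x ∂ρ i)
    {f : (Fin m → Fin n → ℝ) → ℝ≥0∞} (hf : Measurable f)
    (hhom : ∀ i, ∀ r : ℝ, 0 < r → ∀ M,
      f (Function.update M i (r • M i)) = ENNReal.ofReal (r ^ (2 * α)) * f M) :
    ∫⁻ M, f M ∂Measure.pi μ = (∏ i, c i) * ∫⁻ M, f M ∂Measure.pi ρ := by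
  induction m with
  | zero =>
    obtain rfl := Subsingleton.elim μ ρ
    simp
  | succ m ih =>
    have hfc : Measurable fun p : (Fin n → ℝ) × (Fin m → Fin n → ℝ) =>
        f (Fin.cons p.1 p.2) := hf.comp measurable_fin_cons
    have hcons : ∀ r : ℝ, 0 < r → ∀ x (y : Fin m → Fin n → ℝ),
        f (Fin.cons (r • x) y) = ENNReal.ofReal (r ^ (2 * α)) * f (Fin.cons x y) := by
      intro r hr x y
      simpa using hhom 0 r hr (Fin.cons x y)
    have hin : ∀ x, ∫⁻ y, f (Fin.cons x y) ∂(Measure.pi fun i => μ (Fin.succ i)) =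
        (∏ i : Fin m, c i.succ) *
          ∫⁻ y, f (Fin.cons x y) ∂(Measure.pi fun i => ρ (Fin.succ i)) := by
      intro x
      refine ih _ _ _ (fun i => hc i.succ) (fun i => h i.succ)
        (hfc.comp measurable_prodMk_left) fun i r hr M => ?_
      rw [Fin.cons_update]
      simpa using hhom i.succ r hr (Fin.cons x M)
    rw [lintegral_pi_fin_succ μ hf, lintegral_pi_fin_succ ρ hf, lintegral_congr hin,
      lintegral_const_mul' _ _ (ENNReal.prod_ne_top fun i _ => hc i.succ),
      h 0 _ hfc.lintegral_prod_right', Fin.prod_univ_succ]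
    · ring
    · intro r hr x
      rw [← lintegral_const_mul' _ _ ENNReal.ofReal_ne_top]
      exact lintegral_congr fun y => hcons r hr x y

theorem lintegral_exp_neg_sq :
    ∫⁻ x : ℝ, ENNReal.ofReal (exp (-x ^ 2)) = ENNReal.ofReal (π ^ (1 / 2 : ℝ)) := by
  have h := integral_gaussian 1
  have hi := integrable_exp_neg_mul_sq one_pos
  simp only [neg_mul, one_mul, div_one] at h hi
  rw [← sqrt_eq_rpow, ← h, ofReal_integral_eq_lintegral_ofReal hi
    (Filter.Eventually.of_forall fun x => (exp_pos _).le)]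

/-- Deleting the first coordinate of a Gaussian row leaves a Gaussian row. -/
theorem measurePreserving_tail_gaussRowMeasure (n : ℕ) :
    MeasurePreserving (fun x : Fin (n + 1) → ℝ => Fin.tail x)
      (gaussRowMeasure (n + 1)) (gaussRowMeasure n) := by
  have ht : Measurable fun x : Fin (n + 1) → ℝ => Fin.tail x :=
    measurable_pi_iff.2 fun i => measurable_pi_apply i.succ
  refine ⟨ht, Measure.ext_of_lintegral _ fun f hf => ?_⟩
  have hm : Measurable fun x : Fin (n + 1) → ℝ =>
      f (Fin.tail x) * ENNReal.ofReal (exp (-∑ j, x j ^ 2)) :=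
    (hf.comp ht).mul (by fun_prop)
  have hsplit : ∀ (x : ℝ) (y : Fin n → ℝ),
      f (Fin.tail (Fin.cons x y : Fin (n + 1) → ℝ)) *
          ENNReal.ofReal (exp (-∑ j, (Fin.cons x y : Fin (n + 1) → ℝ) j ^ 2)) =
        ENNReal.ofReal (exp (-x ^ 2)) * (f y * ENNReal.ofReal (exp (-∑ j, y j ^ 2))) := by
    intro x y
    rw [Fin.tail_cons, Fin.sum_univ_succ]
    simp only [Fin.cons_zero, Fin.cons_succ]
    rw [neg_add, exp_add, ENNReal.ofReal_mul (exp_pos _).le]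
    ring
  rw [lintegral_map hf ht, lintegral_gaussRowMeasure (g := fun x => f (Fin.tail x)) (hf.comp ht),
    lintegral_gaussRowMeasure hf, volume_pi, lintegral_pi_fin_succ (fun _ => volume) hm, ← volume_pi]
  simp_rw [hsplit]
  rw [lintegral_lintegral_mul (f := fun x : ℝ => ENNReal.ofReal (exp (-x ^ 2)))
      (g := fun y : Fin n → ℝ => f y * ENNReal.ofReal (exp (-∑ j, y j ^ 2)))
      (by fun_prop) (hf.mul (by fun_prop)).aemeasurable, lintegral_exp_neg_sq, ← mul_assoc,
    ← ENNReal.ofReal_mul (by positivity), ← rpow_add pi_pos]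
  congr 4
  push_cast
  ring

instance (n : ℕ) : IsProbabilityMeasure (gaussRowMeasure n) := by
  induction n with
  | zero => exact ⟨by simp [gaussRowMeasure, volume_pi]⟩
  | succ n ih =>
    have h := measurePreserving_tail_gaussRowMeasure n
    exact ⟨by rw [← preimage_univ, h.measure_preimage MeasurableSet.univ.nullMeasurableSet,
      ih.measure_univ]⟩

/-- The Gaussian row distribution is invariant under linear isometries. -/
theorem measurePreserving_isometry_gaussRowMeasure {n : ℕ}
    (L : EuclideanSpace ℝ (Fin n) ≃ₗᵢ[ℝ] EuclideanSpace ℝ (Fin n)) :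
    MeasurePreserving (fun x => WithLp.ofLp (L (WithLp.toLp 2 x)))
      (gaussRowMeasure n) (gaussRowMeasure n) := by
  have hT : MeasurePreserving (fun x : Fin n → ℝ => WithLp.ofLp (L (WithLp.toLp 2 x)))
      volume volume :=
    (PiLp.volume_preserving_ofLp (Fin n)).comp
      (L.measurePreserving.comp (PiLp.volume_preserving_toLp (Fin n)))
  refine ⟨hT.measurable, Measure.ext_of_lintegral _ fun f hf => ?_⟩
  have hq : ∀ x : Fin n → ℝ, ∑ j, WithLp.ofLp (L (WithLp.toLp 2 x)) j ^ 2 = ∑ j, x j ^ 2 := by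
    intro x
    have := L.norm_map (WithLp.toLp 2 x)
    rw [← sq_eq_sq₀ (norm_nonneg _) (norm_nonneg _), EuclideanSpace.norm_sq_eq,
      EuclideanSpace.norm_sq_eq] at this
    simpa using this
  rw [lintegral_map hf hT.measurable, lintegral_gaussRowMeasure
    (g := fun x => f (WithLp.ofLp (L (WithLp.toLp 2 x)))) (hf.comp hT.measurable),
    lintegral_gaussRowMeasure hf]
  have hm : Measurable fun x : Fin n → ℝ => f x * ENNReal.ofReal (exp (-∑ j, x j ^ 2)) :=
    hf.mul (by fun_prop)
  rw [← hT.lintegral_comp hm]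
  simp only [hq]

/-- Moments of the Euclidean norm of a Gaussian row. -/
theorem lintegral_norm_gaussRowMeasure {n : ℕ} (hn : 0 < n) {α : ℝ} (hα : -(1 / 2 : ℝ) < α) :
    ∫⁻ x, ENNReal.ofReal (‖WithLp.toLp 2 x‖ ^ (2 * α)) ∂gaussRowMeasure n =
      ENNReal.ofReal (Real.Gamma ((n : ℝ) / 2 + α) / Real.Gamma ((n : ℝ) / 2)) := by
  obtain ⟨S, hS⟩ := exists_lintegral_homogeneous_mul_radial hn 0 (g := fun _ => 1)
    measurable_const (by simp)
  simp only [one_mul, add_zero] at hS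
  have hn' : (1 : ℝ) ≤ n := by exact_mod_cast hn
  have ha : 0 < (n : ℝ) / 2 + α := by linarith
  have hb : 0 < (n : ℝ) / 2 := by positivity
  have hΓ := Real.Gamma_pos_of_pos hb
  have hone : ENNReal.ofReal (π ^ (-(n : ℝ) / 2)) * (S * ENNReal.ofReal (Real.Gamma ((n : ℝ) / 2)))
      = 1 := by
    have h1 : ∫⁻ _, 1 ∂gaussRowMeasure n = 1 := by simp
    rwa [lintegral_gaussRowMeasure measurable_const, lintegral_congr fun x => one_mul _,
      hS (fun t => ENNReal.ofReal (exp (-t))) (by fun_prop), lintegral_rpow_mul_exp_neg hb] at h1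
  have hnorm : ∀ x : Fin n → ℝ, ENNReal.ofReal (‖WithLp.toLp 2 x‖ ^ (2 * α)) =
      ENNReal.ofReal ((∑ j, x j ^ 2) ^ α) := by
    intro x
    have h := EuclideanSpace.norm_sq_eq (WithLp.toLp 2 x)
    simp only [norm_eq_abs, sq_abs] at h
    rw [← h, rpow_mul (norm_nonneg _), rpow_two]
  have hradial : ∫⁻ t in Ioi (0 : ℝ), ENNReal.ofReal (t ^ ((n : ℝ) / 2 - 1)) *
        (ENNReal.ofReal (t ^ α) * ENNReal.ofReal (exp (-t))) =
      ENNReal.ofReal (Real.Gamma ((n : ℝ) / 2 + α)) := by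
    rw [← lintegral_rpow_mul_exp_neg ha]
    refine setLIntegral_congr_fun measurableSet_Ioi fun t (ht : 0 < t) => ?_
    rw [← mul_assoc, ← ENNReal.ofReal_mul (by positivity), ← rpow_add ht]
    congr 3
    ring
  simp_rw [hnorm]
  rw [lintegral_gaussRowMeasure (by fun_prop),
    hS (fun t => ENNReal.ofReal (t ^ α) * ENNReal.ofReal (exp (-t))) (by fun_prop), hradial,
    ← mul_one (ENNReal.ofReal (_ / _)), ← hone, mul_left_comm _ S, mul_left_comm _ S,
    mul_left_comm _ S, ← ENNReal.ofReal_mul (by positivity), ← ENNReal.ofReal_mul (by positivity),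
    ← ENNReal.ofReal_mul (by have := Real.Gamma_pos_of_pos ha; positivity)]
  congr 2
  field_simp

/-- Applying a linear isometry to every row does not change the absolute value of the
determinant. -/
theorem abs_det_isometry_rows {n : ℕ}
    (L : EuclideanSpace ℝ (Fin n) ≃ₗᵢ[ℝ] EuclideanSpace ℝ (Fin n)) (M : Fin n → Fin n → ℝ) :
    |Matrix.det (Matrix.of fun i => WithLp.ofLp (L (WithLp.toLp 2 (M i))))| =
      |Matrix.det (Matrix.of M)| := by
  have hgram : ∀ A : Fin n → Fin n → ℝ, Matrix.det (Matrix.of A) ^ 2 = Matrix.det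
      (Matrix.of fun i j => inner ℝ (WithLp.toLp 2 (A i) : EuclideanSpace ℝ (Fin n))
        (WithLp.toLp 2 (A j))) := by
    intro A
    rw [sq]
    nth_rewrite 2 [← Matrix.det_transpose]
    rw [← Matrix.det_mul]
    congr 1
    ext i j
    simp [Matrix.mul_apply, PiLp.inner_apply, mul_comm]
  rw [← sq_eq_sq_iff_abs_eq_abs, hgram, hgram]
  simp

/-- Expansion of the determinant along a first row supported on the first coordinate. -/
theorem det_cons_single {n : ℕ} (r : ℝ) (y : Fin n → Fin (n + 1) → ℝ) :
    Matrix.det (Matrix.of (Fin.cons (Pi.single 0 r) y : Fin (n + 1) → Fin (n + 1) → ℝ)) =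
      r * Matrix.det (Matrix.of fun i => Fin.tail (y i)) := by
  rw [Matrix.det_succ_row_zero, Finset.sum_eq_single 0]
  · simp only [Fin.val_zero, pow_zero, one_mul, Matrix.of_apply, Fin.cons_zero, Pi.single_eq_same]
    congr 2
  · intro j _ hj
    simp [Pi.single_eq_of_ne hj]
  · simp

/-- Moments of the determinant of a square matrix with independent Gaussian rows. -/
theorem lintegral_det_gaussRowMeasure {α : ℝ} (hα : -(1 / 2 : ℝ) < α) (n : ℕ) :
    ∫⁻ M : Fin n → Fin n → ℝ, ENNReal.ofReal (|Matrix.det (Matrix.of M)| ^ (2 * α))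
        ∂(Measure.pi fun _ => gaussRowMeasure n) =
      ∏ l : Fin n, ENNReal.ofReal
        (Real.Gamma (((n : ℝ) - (l : ℕ)) / 2 + α) / Real.Gamma (((n : ℝ) - (l : ℕ)) / 2)) := by
  have hmeas : ∀ k : ℕ, Measurable fun M : Fin k → Fin k → ℝ =>
      ENNReal.ofReal (|Matrix.det (Matrix.of M)| ^ (2 * α)) := by
    intro k
    have : Measurable fun M : Fin k → Fin k → ℝ => Matrix.det (Matrix.of M) :=
      (Continuous.matrix_det (by fun_prop)).measurable
    fun_prop
  induction n with
  | zero => simp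
  | succ n ih =>
    have hinner : ∀ x : Fin (n + 1) → ℝ,
        ∫⁻ y : Fin n → Fin (n + 1) → ℝ, ENNReal.ofReal
          (|Matrix.det (Matrix.of (Fin.cons x y : Fin (n + 1) → Fin (n + 1) → ℝ))| ^ (2 * α))
          ∂(Measure.pi fun _ => gaussRowMeasure (n + 1)) =
        ENNReal.ofReal (‖WithLp.toLp 2 x‖ ^ (2 * α)) *
          ∫⁻ M : Fin n → Fin n → ℝ, ENNReal.ofReal (|Matrix.det (Matrix.of M)| ^ (2 * α))
            ∂(Measure.pi fun _ => gaussRowMeasure n) := by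
      intro x
      obtain ⟨L, hL⟩ : ∃ L : EuclideanSpace ℝ (Fin (n + 1)) ≃ₗᵢ[ℝ] EuclideanSpace ℝ (Fin (n + 1)),
          L (WithLp.toLp 2 x) = EuclideanSpace.single 0 ‖WithLp.toLp 2 x‖ :=
        ⟨_, Submodule.reflection_sub (by simp)⟩
      have hrot := measurePreserving_pi (fun _ : Fin n => gaussRowMeasure (n + 1))
        (fun _ => gaussRowMeasure (n + 1))
        fun _ => measurePreserving_isometry_gaussRowMeasure L
      have htail := measurePreserving_pi (fun _ : Fin n => gaussRowMeasure (n + 1))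
        (fun _ => gaussRowMeasure n) fun _ => measurePreserving_tail_gaussRowMeasure n
      have hdet : ∀ y : Fin n → Fin (n + 1) → ℝ,
          |Matrix.det (Matrix.of (Fin.cons x y : Fin (n + 1) → Fin (n + 1) → ℝ))| =
            ‖WithLp.toLp 2 x‖ * |Matrix.det (Matrix.of fun i => Fin.tail
              (WithLp.ofLp (L (WithLp.toLp 2 (y i)))))| := by
        intro y
        have hrows : (fun i => WithLp.ofLp (L (WithLp.toLp 2
              ((Fin.cons x y : Fin (n + 1) → Fin (n + 1) → ℝ) i)))) =
            Fin.cons (Pi.single 0 ‖WithLp.toLp 2 x‖)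
              (fun i => WithLp.ofLp (L (WithLp.toLp 2 (y i)))) := by
          funext i
          cases i using Fin.cases with
          | zero => simp [hL]
          | succ i => simp
        rw [← abs_det_isometry_rows L, hrows, det_cons_single, abs_mul,
          abs_of_nonneg (norm_nonneg _)]
      have hcomp := (htail.comp hrot).lintegral_comp (hmeas n)
      rw [← hcomp, ← lintegral_const_mul' _ _ ENNReal.ofReal_ne_top]
      refine lintegral_congr fun y => ?_
      rw [hdet, mul_rpow (norm_nonneg _) (abs_nonneg _), ENNReal.ofReal_mul (by positivity)]
      rfl
    rw [lintegral_pi_fin_succ _ (hmeas _), lintegral_congr hinner, lintegral_mul_const _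
      (by fun_prop), lintegral_norm_gaussRowMeasure n.succ_pos hα, ih, Fin.prod_univ_succ]
    congr 1
    · simp
    · refine Finset.prod_congr rfl fun i _ => ?_
      simp

theorem statement2 (N : ℕ) (hN : 0 < N) (ν : Fin N → ℝ) (hν : ∀ l, 0 < ν l)
    (α : ℝ) (hα : -(1 / 2 : ℝ) < α) :
    Integrable (fun M : Fin N → Fin N → ℝ => |Matrix.det (Matrix.of M)| ^ (2 * α))
      (Measure.pi fun l => betaIRowMeasure N (ν l)) ∧
    ∫ M : Fin N → Fin N → ℝ, |Matrix.det (Matrix.of M)| ^ (2 * α)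
        ∂(Measure.pi fun l => betaIRowMeasure N (ν l)) =
      ∏ l : Fin N,
        (Real.Gamma (((N : ℝ) - (l : ℕ)) / 2 + α) / Real.Gamma (((N : ℝ) - (l : ℕ)) / 2)) *
          (Real.Gamma (((N : ℝ) + ν l) / 2) / Real.Gamma (((N : ℝ) + ν l) / 2 + α)) := by
  have hdet : Measurable fun M : Fin N → Fin N → ℝ => Matrix.det (Matrix.of M) :=
    (Continuous.matrix_det (by fun_prop)).measurable
  have hmeas : Measurable fun M : Fin N → Fin N → ℝ =>
      |Matrix.det (Matrix.of M)| ^ (2 * α) := by fun_prop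
  have hfac : ∀ l : Fin N,
      0 ≤ Real.Gamma (((N : ℝ) - (l : ℕ)) / 2 + α) / Real.Gamma (((N : ℝ) - (l : ℕ)) / 2) ∧
        0 ≤ Real.Gamma (((N : ℝ) + ν l) / 2) / Real.Gamma (((N : ℝ) + ν l) / 2 + α) := by
    intro l
    have hl : ((l : ℕ) : ℝ) + 1 ≤ N := by exact_mod_cast l.2
    have hl0 : (0 : ℝ) ≤ (l : ℕ) := Nat.cast_nonneg _
    have := hν l
    exact ⟨div_nonneg (Real.Gamma_pos_of_pos (by linarith)).le
        (Real.Gamma_pos_of_pos (by linarith)).le,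
      div_nonneg (Real.Gamma_pos_of_pos (by linarith)).le
        (Real.Gamma_pos_of_pos (by linarith)).le⟩
  have hL : ∫⁻ M : Fin N → Fin N → ℝ, ENNReal.ofReal (|Matrix.det (Matrix.of M)| ^ (2 * α))
        ∂(Measure.pi fun l => betaIRowMeasure N (ν l)) = ENNReal.ofReal (∏ l : Fin N,
        (Real.Gamma (((N : ℝ) - (l : ℕ)) / 2 + α) / Real.Gamma (((N : ℝ) - (l : ℕ)) / 2)) *
          (Real.Gamma (((N : ℝ) + ν l) / 2) / Real.Gamma (((N : ℝ) + ν l) / 2 + α))) := by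
    rw [lintegral_pi_eq_prod_mul α _ (fun _ => gaussRowMeasure N)
      (fun l => ENNReal.ofReal
        (Real.Gamma (((N : ℝ) + ν l) / 2) / Real.Gamma (((N : ℝ) + ν l) / 2 + α)))
      (fun _ => ENNReal.ofReal_ne_top)
      (fun l g hg hhom => lintegral_betaIRowMeasure_eq hN (hν l) hα hg hhom)
      hmeas.ennreal_ofReal, lintegral_det_gaussRowMeasure hα, ← Finset.prod_mul_distrib,
      ENNReal.ofReal_prod_of_nonneg fun l _ => mul_nonneg (hfac l).1 (hfac l).2]
    · refine Finset.prod_congr rfl fun l _ => ?_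
      rw [ENNReal.ofReal_mul (hfac l).1, mul_comm]
    · intro l r hr M
      have h := Matrix.det_updateRow_smul (Matrix.of M) l r (M l)
      rw [show (Matrix.of M).updateRow l (M l) =
        Matrix.of M from Matrix.updateRow_eq_self _ _] at h
      rw [← ENNReal.ofReal_mul (by positivity), ← mul_rpow hr.le (abs_nonneg _), ← abs_of_pos hr,
        ← abs_mul, abs_of_pos hr, ← h]
      rfl
  have hnonneg : 0 ≤ᵐ[Measure.pi fun l => betaIRowMeasure N (ν l)]
      fun M : Fin N → Fin N → ℝ => |Matrix.det (Matrix.of M)| ^ (2 * α) :=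
    Filter.Eventually.of_forall fun M => by positivity
  refine ⟨(lintegral_ofReal_ne_top_iff_integrable hmeas.aestronglyMeasurable hnonneg).1
    (hL ▸ ENNReal.ofReal_ne_top), ?_⟩
  rw [integral_eq_lintegral_of_nonneg_ae hnonneg hmeas.aestronglyMeasurable, hL,
    ENNReal.toReal_ofReal (Finset.prod_nonneg fun l _ => mul_nonneg (hfac l).1 (hfac l).2)]
end

section
/- Let N be a positive integer and let ν_1, …, ν_N > 0. Let X be a random N×N real matrix whose rows are independent, with row l distributed according to the beta type I density π^{-N/2} (Γ((ν_l+N)/2)/Γ(ν_l/2)) (1−|x|²)^{ν_l/2−1} supported on the open unit ball of ℝ^N. Then the law of |det X|² equals the law of ∏_{l=1}^N B_l, where B_1, …, B_N are independent and B_l has the Beta[(N−l+1)/2, (ν_l+l−1)/2] distribution. -/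
open MeasureTheory Real

/-- The beta distribution `Beta[a,b]`: the measure on `(0,1)` with density
`x^{a-1}(1-x)^{b-1} Γ(a+b)/(Γ(a)Γ(b))` with respect to Lebesgue measure. -/
noncomputable def betaMeas (a b : ℝ) : Measure ℝ :=
  volume.withDensity fun x =>
    ENNReal.ofReal (if 0 < x ∧ x < 1 then
      x ^ (a - 1) * (1 - x) ^ (b - 1) * Real.Gamma (a + b) / (Real.Gamma a * Real.Gamma b)
    else 0)

lemma measurable_sum_sq (n : ℕ) : Measurable fun x : Fin n → ℝ => ∑ j, x j ^ 2 := by fun_prop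

lemma volume_sum_sq_lt (n : ℕ) (r : ℝ) (hr : 0 ≤ r) :
    volume {x : Fin (n + 1) → ℝ | ∑ j, x j ^ 2 < r} =
      ENNReal.ofReal (r ^ (((n + 1 : ℕ) : ℝ) / 2) *
        (π ^ (((n + 1 : ℕ) : ℝ) / 2) / Gamma (((n + 1 : ℕ) : ℝ) / 2 + 1))) := by
  have h := EuclideanSpace.volume_ball _ (0 : EuclideanSpace ℝ (Fin (n + 1))) (√r)
  rw [← (PiLp.volume_preserving_toLp (Fin (n + 1))).measure_preimage
    measurableSet_ball.nullMeasurableSet] at h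
  have hs : WithLp.toLp 2 ⁻¹' Metric.ball (0 : EuclideanSpace ℝ (Fin (n + 1))) (√r) =
      {x : Fin (n + 1) → ℝ | ∑ j, x j ^ 2 < r} := by
    ext x
    simp only [Set.mem_preimage, mem_ball_zero_iff, EuclideanSpace.norm_eq, Set.mem_ofPred_eq,
      Real.norm_eq_abs, sq_abs]
    exact Real.sqrt_lt_sqrt_iff (by positivity)
  rw [← hs, h, ← ENNReal.ofReal_pow (by positivity), ← ENNReal.ofReal_mul (by positivity)]
  have hp : ∀ t : ℝ, 0 ≤ t → √t ^ (n + 1) = t ^ (((n + 1 : ℕ) : ℝ) / 2) := fun t ht => by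
    rw [Real.sqrt_eq_rpow, ← Real.rpow_natCast, ← Real.rpow_mul ht]
    congr 1
    ring
  simp [hp _ hr, hp _ Real.pi_pos.le]

lemma setLIntegral_Ioo_rpow (p r : ℝ) (hp : 0 < p) (hr : 0 ≤ r) :
    ∫⁻ u in Set.Ioo 0 r, ENNReal.ofReal (u ^ (p - 1)) = ENNReal.ofReal (r ^ p / p) := by
  rw [Measure.restrict_congr_set Ioo_ae_eq_Ioc, ← ofReal_integral_eq_lintegral_ofReal,
    ← intervalIntegral.integral_of_le hr, integral_rpow (Or.inl (by linarith))]
  · simp [Real.zero_rpow hp.ne']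
  · exact (intervalIntegral.intervalIntegrable_rpow' (by linarith)).1
  · filter_upwards [ae_restrict_mem measurableSet_Ioc] with y hy
    exact Real.rpow_nonneg hy.1.le _

/-- The image of Lebesgue measure under the squared Euclidean norm. -/
lemma map_sum_sq_volume (n : ℕ) :
    Measure.map (fun x : Fin (n + 1) → ℝ => ∑ j, x j ^ 2) volume =
      volume.withDensity (Set.indicator (Set.Ioi 0) fun u => ENNReal.ofReal
        (π ^ (((n + 1 : ℕ) : ℝ) / 2) / Gamma (((n + 1 : ℕ) : ℝ) / 2)) *
          ENNReal.ofReal (u ^ (((n + 1 : ℕ) : ℝ) / 2 - 1))) := by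
  have hm := measurable_sum_sq (n + 1)
  have hp : (0 : ℝ) < ((n + 1 : ℕ) : ℝ) / 2 := by positivity
  have key : ∀ r : ℝ, Measure.map (fun x : Fin (n + 1) → ℝ => ∑ j, x j ^ 2) volume (Set.Iio r) =
      volume {x : Fin (n + 1) → ℝ | ∑ j, x j ^ 2 < r} := fun r => by
    rw [Measure.map_apply hm measurableSet_Iio]
    rfl
  refine Measure.ext_of_generateFrom_of_iUnion (Set.range Set.Iio) (fun k : ℕ => Set.Iio (k : ℝ))
    ?_ isPiSystem_Iio ?_ (fun k => Set.mem_range_self _) ?_ ?_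
  · rw [BorelSpace.measurable_eq (α := ℝ), borel_eq_generateFrom_Iio]
  · exact Set.iUnion_eq_univ_iff.2 fun x => exists_nat_gt x
  · intro k
    rw [key, volume_sum_sq_lt n k (by positivity)]
    exact ENNReal.ofReal_ne_top
  · rintro _ ⟨r, rfl⟩
    rw [key, withDensity_apply _ measurableSet_Iio, lintegral_indicator measurableSet_Ioi,
      Measure.restrict_restrict measurableSet_Ioi, Set.Ioi_inter_Iio,
      lintegral_const_mul' _ _ ENNReal.ofReal_ne_top]
    rcases le_or_gt 0 r with hr | hr
    · rw [volume_sum_sq_lt n r hr, setLIntegral_Ioo_rpow _ _ hp hr,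
        ← ENNReal.ofReal_mul (by have := Real.Gamma_pos_of_pos hp; positivity),
        Real.Gamma_add_one hp.ne']
      congr 1
      have := (Real.Gamma_pos_of_pos hp).ne'
      field_simp
    · rw [Set.Ioo_eq_empty (by linarith)]
      have : {x : Fin (n + 1) → ℝ | ∑ j, x j ^ 2 < r} = ∅ := by
        ext x
        simp only [Set.mem_ofPred_eq, Set.mem_empty_iff_false, iff_false, not_lt]
        exact hr.le.trans (by positivity)
      simp [this]

lemma lintegral_sum_sq (n : ℕ) (f : ℝ → ENNReal) (hf : Measurable f) :
    ∫⁻ x : Fin (n + 1) → ℝ, f (∑ j, x j ^ 2) =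
      ∫⁻ u in Set.Ioi 0, ENNReal.ofReal
        (π ^ (((n + 1 : ℕ) : ℝ) / 2) / Gamma (((n + 1 : ℕ) : ℝ) / 2)) *
          ENNReal.ofReal (u ^ (((n + 1 : ℕ) : ℝ) / 2 - 1)) * f u := by
  rw [← lintegral_map hf (measurable_sum_sq _), map_sum_sq_volume,
    lintegral_withDensity_eq_lintegral_mul _ (by measurability) hf,
    ← lintegral_indicator measurableSet_Ioi]
  refine lintegral_congr fun u => ?_
  by_cases hu : u ∈ Set.Ioi (0 : ℝ) <;> simp [hu]

lemma setLIntegral_beta (a b c : ℝ) (ha : 0 < a) (hb : 0 < b) (hc : 0 < c) :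
    ∫⁻ u in Set.Ioo 0 c, ENNReal.ofReal (u ^ (a - 1) * (c - u) ^ (b - 1)) =
      ENNReal.ofReal (c ^ (a + b - 1) * ProbabilityTheory.beta a b) := by
  have h1 := ProbabilityTheory.lintegral_betaPDF_eq_one ha hb
  have hB := ProbabilityTheory.beta_pos ha hb
  rw [← lintegral_indicator measurableSet_Ioo, ← Real.smul_map_volume_mul_left hc.ne',
    lintegral_smul_measure, lintegral_map (by measurability) (by fun_prop)]
  have h2 : ∀ x : ℝ, (Set.Ioo 0 c).indicator
      (fun u => ENNReal.ofReal (u ^ (a - 1) * (c - u) ^ (b - 1))) (c * x) =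
      ENNReal.ofReal (c ^ (a + b - 2) * ProbabilityTheory.beta a b) *
        ProbabilityTheory.betaPDF a b x := fun x => by
    rw [ProbabilityTheory.betaPDF_eq, ← ENNReal.ofReal_mul (by positivity)]
    by_cases hx : 0 < x ∧ x < 1
    · have : c * x ∈ Set.Ioo 0 c := ⟨mul_pos hc hx.1, by nlinarith [hx.2]⟩
      rw [Set.indicator_of_mem this, if_pos hx, Real.mul_rpow hc.le hx.1.le,
        show c - c * x = c * (1 - x) by ring, Real.mul_rpow hc.le (by linarith [hx.2]),
        show a + b - 2 = (a - 1) + (b - 1) by ring, Real.rpow_add hc]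
      congr 1
      field_simp
    · have : c * x ∉ Set.Ioo 0 c := fun h =>
        hx ⟨(mul_pos_iff_of_pos_left hc).1 h.1, by have := h.2; nlinarith⟩
      rw [Set.indicator_of_notMem this, if_neg hx]
      simp
  simp_rw [h2]
  rw [lintegral_const_mul' _ _ ENNReal.ofReal_ne_top, h1, abs_of_pos hc, smul_eq_mul, mul_one,
    ← ENNReal.ofReal_mul hc.le, show a + b - 1 = 1 + (a + b - 2) by ring, Real.rpow_add hc,
    Real.rpow_one, mul_assoc]

/-- An orthogonal matrix taking a given vector to a multiple of the first basis vector. -/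
lemma exists_orthogonal_mulVec_eq_single (n : ℕ) (x : Fin (n + 1) → ℝ) :
    ∃ U : Matrix (Fin (n + 1)) (Fin (n + 1)) ℝ, U * U.transpose = 1 ∧
      U.mulVec x = Pi.single 0 √(∑ j, x j ^ 2) := by
  by_cases hx : x = 0
  · exact ⟨1, by simp, by simp [hx]⟩
  set y : EuclideanSpace ℝ (Fin (n + 1)) := WithLp.toLp 2 x with hy
  have hy0 : y ≠ 0 := by simpa [hy] using hx
  have hyn : ‖y‖ = √(∑ j, x j ^ 2) := by simp [hy, EuclideanSpace.norm_eq]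
  have ho : Orthonormal ℝ (({0} : Set (Fin (n + 1))).domRestrict fun _ => (‖y‖⁻¹ • y)) := by
    rw [orthonormal_iff_ite]
    rintro ⟨i, rfl⟩ ⟨j, rfl⟩
    have : ‖y‖ ≠ 0 := by simpa using hy0
    simp [norm_smul, this]
  obtain ⟨b, hb⟩ := ho.exists_orthonormalBasis_extension_of_card_eq (by simp)
  have hb0 := hb 0 rfl
  have hyb : y = ‖y‖ • b 0 := by
    rw [hb0, smul_smul, mul_inv_cancel₀ (by simpa using hy0), one_smul]
  refine ⟨Matrix.of fun i j => b i j, ?_, ?_⟩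
  · ext i j
    have := orthonormal_iff_ite.1 b.orthonormal i j
    simp only [PiLp.inner_apply, RCLike.inner_apply, conj_trivial] at this
    rw [Matrix.mul_apply, Matrix.one_apply, ← this]
    exact Finset.sum_congr rfl fun k _ => mul_comm _ _
  · ext i
    have h1 : (Matrix.of fun i j => b i j).mulVec x i = inner ℝ (b i) y := by
      simp only [PiLp.inner_apply, RCLike.inner_apply, conj_trivial, Matrix.mulVec, dotProduct]
      exact Finset.sum_congr rfl fun k _ => mul_comm _ _
    rw [h1, hyb, real_inner_smul_right, orthonormal_iff_ite.1 b.orthonormal i 0, hyn]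
    simp [Pi.single_apply]

lemma det_sq_eq_one_of_mul_transpose {ι : Type*} [Fintype ι] [DecidableEq ι]
    (U : Matrix ι ι ℝ) (hU : U * U.transpose = 1) : U.det ^ 2 = 1 := by
  have := congrArg Matrix.det hU
  rwa [Matrix.det_mul, Matrix.det_transpose, Matrix.det_one, ← sq] at this

lemma det_cons_sq_of_orthogonal (n : ℕ) (x : Fin (n + 1) → ℝ) (Y : Fin n → Fin (n + 1) → ℝ)
    (U : Matrix (Fin (n + 1)) (Fin (n + 1)) ℝ) (hU : U * U.transpose = 1) (r : ℝ)
    (hx : U.mulVec x = Pi.single 0 r) :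
    (Matrix.of (Fin.cons x Y : Fin (n + 1) → Fin (n + 1) → ℝ)).det ^ 2 =
      r ^ 2 * (Matrix.of fun i => Fin.tail (U.mulVec (Y i))).det ^ 2 := by
  set M : Matrix (Fin (n + 1)) (Fin (n + 1)) ℝ := Matrix.of (Fin.cons x Y) with hM
  have hd := det_sq_eq_one_of_mul_transpose U hU
  have hrow : ∀ i j, (M * U.transpose) i j = U.mulVec (M i) j := fun i j => by
    simp only [Matrix.mul_apply, Matrix.mulVec, dotProduct, Matrix.transpose_apply]
    exact Finset.sum_congr rfl fun k _ => mul_comm _ _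
  have h0 : ∀ j, (M * U.transpose) 0 j = (Pi.single 0 r : Fin (n + 1) → ℝ) j := fun j => by
    rw [hrow, ← hx]
    rfl
  have hdet : (M * U.transpose).det =
      r * (Matrix.of fun i => Fin.tail (U.mulVec (Y i))).det := by
    rw [Matrix.det_succ_row_zero, Finset.sum_eq_single 0]
    · rw [h0]
      simp only [Fin.val_zero, pow_zero, one_mul, Pi.single_eq_same]
      congr 2
      ext i j
      exact hrow _ _
    · intro j _ hj
      simp [h0, hj]
    · simp
  calc M.det ^ 2 = (M * U.transpose).det ^ 2 := by
        rw [Matrix.det_mul, Matrix.det_transpose, mul_pow, hd, mul_one]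
    _ = _ := by rw [hdet, mul_pow]

lemma measurePreserving_mulVec_betaIRowMeasure (N : ℕ) (ν : ℝ) (U : Matrix (Fin N) (Fin N) ℝ)
    (hU : U * U.transpose = 1) :
    MeasurePreserving U.mulVec (betaIRowMeasure N ν) (betaIRowMeasure N ν) := by
  have hd := det_sq_eq_one_of_mul_transpose U hU
  have hd0 : U.det ≠ 0 := fun h => by simp [h] at hd
  have hm : Measurable U.mulVec := (Matrix.toLin' U).continuous_of_finiteDimensional.measurable
  have hv : MeasurePreserving U.mulVec volume volume := by
    refine ⟨hm, ?_⟩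
    have := Real.map_matrix_volume_pi_eq_smul_volume_pi hd0
    rw [show (⇑(Matrix.toLin' U) : (Fin N → ℝ) → Fin N → ℝ) = U.mulVec from rfl] at this
    rw [this, abs_inv, (abs_pow_eq_one _ two_ne_zero).1 (by rw [hd, abs_one])]
    simp
  have hn : ∀ x, ∑ j, U.mulVec x j ^ 2 = ∑ j, x j ^ 2 := fun x => by
    have h1 : ∀ z : Fin N → ℝ, ∑ j, z j ^ 2 = dotProduct z z := fun z => by
      simp [dotProduct, sq]
    rw [h1, h1, Matrix.dotProduct_mulVec, ← Matrix.mulVec_transpose, Matrix.mulVec_mulVec,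
      mul_eq_one_comm.1 hU, Matrix.one_mulVec]
  refine ⟨hm, Measure.ext fun s hs => ?_⟩
  rw [Measure.map_apply hm hs, betaIRowMeasure, withDensity_apply _ (hm hs),
    withDensity_apply _ hs, ← hv.setLIntegral_comp_preimage hs]
  · simp_rw [hn]
  · refine Measurable.ennreal_ofReal (Measurable.ite ?_ (by fun_prop) (by fun_prop))
    exact measurableSet_lt (by fun_prop) (by fun_prop)

lemma lintegral_real_sq (f : ℝ → ENNReal) (hf : Measurable f) :
    ∫⁻ t : ℝ, f (t ^ 2) =
      ∫⁻ u in Set.Ioi 0, ENNReal.ofReal (u ^ ((1 : ℝ) / 2 - 1)) * f u := by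
  have h := lintegral_sum_sq 0 f hf
  have hc : π ^ (((0 + 1 : ℕ) : ℝ) / 2) / Gamma (((0 + 1 : ℕ) : ℝ) / 2) = 1 := by
    rw [zero_add, Nat.cast_one, Real.Gamma_one_half_eq, Real.sqrt_eq_rpow]
    exact div_self (by positivity)
  rw [hc] at h
  rw [← (volume_preserving_funUnique (Fin 1) ℝ).lintegral_comp (by fun_prop)]
  simp only [zero_add, Nat.cast_one, ENNReal.ofReal_one, one_mul] at h
  rw [← h]
  congr! with x
  simp

lemma lintegral_one_sub_sq_add (K ν s : ℝ) (hK : 0 ≤ K) (hν : 0 < ν) :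
    ∫⁻ t : ℝ, ENNReal.ofReal (if t ^ 2 + s < 1 then K * (1 - (t ^ 2 + s)) ^ (ν / 2 - 1) else 0) =
      ENNReal.ofReal (if s < 1 then K * ProbabilityTheory.beta (1 / 2) (ν / 2) *
        (1 - s) ^ ((ν + 1) / 2 - 1) else 0) := by
  by_cases hs : s < 1
  · rw [lintegral_real_sq (fun u => ENNReal.ofReal
      (if u + s < 1 then K * (1 - (u + s)) ^ (ν / 2 - 1) else 0))]
    · rw [if_pos hs, ← lintegral_indicator measurableSet_Ioi]
      have h := setLIntegral_beta (1 / 2) (ν / 2) (1 - s) (by norm_num) (by positivity)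
        (by linarith)
      rw [show K * ProbabilityTheory.beta (1 / 2) (ν / 2) * (1 - s) ^ ((ν + 1) / 2 - 1) =
        K * ((1 - s) ^ (1 / 2 + ν / 2 - 1) * ProbabilityTheory.beta (1 / 2) (ν / 2)) by
          rw [show (ν + 1) / 2 - 1 = 1 / 2 + ν / 2 - 1 by ring]; ring,
        ENNReal.ofReal_mul hK, ← h, ← lintegral_indicator measurableSet_Ioo,
        ← lintegral_const_mul' _ _ ENNReal.ofReal_ne_top]
      refine lintegral_congr fun u => ?_
      by_cases hu : 0 < u
      · by_cases hu1 : u + s < 1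
        · rw [Set.indicator_of_mem (Set.mem_Ioi.2 hu),
            Set.indicator_of_mem (Set.mem_Ioo.2 ⟨hu, by linarith⟩), if_pos hu1,
            ← ENNReal.ofReal_mul (by positivity), ← ENNReal.ofReal_mul hK,
            sub_add_eq_sub_sub_swap]
          congr 1
          ring
        · rw [Set.indicator_of_mem (Set.mem_Ioi.2 hu),
            Set.indicator_of_notMem fun h => hu1 (by linarith [h.2]), if_neg hu1]
          simp
      · rw [Set.indicator_of_notMem (s := Set.Ioi 0) hu,
          Set.indicator_of_notMem (s := Set.Ioo 0 _) fun h => hu h.1, mul_zero]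
    · exact Measurable.ennreal_ofReal (Measurable.ite
        (measurableSet_lt (by fun_prop) (by fun_prop)) (by fun_prop) (by fun_prop))
  · rw [if_neg hs]
    have : ∀ t : ℝ, ¬ t ^ 2 + s < 1 := fun t h => hs (by nlinarith [sq_nonneg t])
    simp [this]

lemma betaIRow_const_mul_beta (n : ℕ) (ν : ℝ) (hν : 0 < ν) :
    π ^ (-((n + 1 : ℕ) : ℝ) / 2) * (Gamma ((ν + (n + 1 : ℕ)) / 2) / Gamma (ν / 2)) *
        ProbabilityTheory.beta (1 / 2) (ν / 2) =
      π ^ (-(n : ℝ) / 2) * (Gamma ((ν + 1 + n) / 2) / Gamma ((ν + 1) / 2)) := by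
  have h1 := (Real.Gamma_pos_of_pos (half_pos hν)).ne'
  have h2 := (Real.Gamma_pos_of_pos (show 0 < (ν + 1) / 2 by positivity)).ne'
  have h3 : π ^ (-(n : ℝ) / 2) = π ^ (-((n + 1 : ℕ) : ℝ) / 2) * √π := by
    rw [Real.sqrt_eq_rpow, ← Real.rpow_add Real.pi_pos]
    congr 1
    push_cast
    ring
  rw [ProbabilityTheory.beta, Real.Gamma_one_half_eq, h3,
    show (1 : ℝ) / 2 + ν / 2 = (ν + 1) / 2 by ring,
    show (ν + (n + 1 : ℕ)) / 2 = (ν + 1 + n) / 2 by push_cast; ring]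
  field_simp

lemma measurable_betaIRow_density (K p : ℝ) :
    Measurable fun u : ℝ => ENNReal.ofReal (if u < 1 then K * (1 - u) ^ p else 0) :=
  Measurable.ennreal_ofReal (Measurable.ite measurableSet_Iio (by fun_prop) (by fun_prop))

lemma betaIRow_const_nonneg (N : ℕ) (ν : ℝ) (hν : 0 < ν) :
    0 ≤ π ^ (-(N : ℝ) / 2) * (Gamma ((ν + N) / 2) / Gamma (ν / 2)) := by
  have h1 := Real.Gamma_pos_of_pos (half_pos hν)
  have h2 := Real.Gamma_pos_of_pos (show 0 < (ν + N) / 2 by positivity)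
  positivity

/-- Deleting a coordinate of a beta type I vector raises the parameter by one. -/
lemma map_tail_betaIRowMeasure (n : ℕ) (ν : ℝ) (hν : 0 < ν) :
    Measure.map (Fin.tail : (Fin (n + 1) → ℝ) → Fin n → ℝ) (betaIRowMeasure (n + 1) ν) =
      betaIRowMeasure n (ν + 1) := by
  have hm : Measurable (Fin.tail : (Fin (n + 1) → ℝ) → Fin n → ℝ) :=
    measurable_pi_lambda _ fun i => measurable_pi_apply _
  have hK := betaIRow_const_nonneg (n + 1) ν hν
  have hC := betaIRow_const_mul_beta n ν hν
  set K := π ^ (-((n + 1 : ℕ) : ℝ) / 2) * (Gamma ((ν + (n + 1 : ℕ)) / 2) / Gamma (ν / 2))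
  have hd := measurable_betaIRow_density K (ν / 2 - 1)
  ext s hs
  rw [Measure.map_apply hm hs, betaIRowMeasure, betaIRowMeasure, withDensity_apply _ (hm hs),
    withDensity_apply _ hs, ← lintegral_indicator (hm hs), ← lintegral_indicator hs]
  let G : ℝ × (Fin n → ℝ) → ENNReal := (Prod.snd ⁻¹' s).indicator fun p => ENNReal.ofReal
    (if p.1 ^ 2 + ∑ j, p.2 j ^ 2 < 1 then
      K * (1 - (p.1 ^ 2 + ∑ j, p.2 j ^ 2)) ^ (ν / 2 - 1) else 0)
  have hG : Measurable G :=
    (hd.comp (f := fun p : ℝ × (Fin n → ℝ) => p.1 ^ 2 + ∑ j, p.2 j ^ 2) (by fun_prop)).indicator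
      (measurable_snd hs)
  calc _ = ∫⁻ x : Fin (n + 1) → ℝ,
        G (MeasurableEquiv.piFinSuccAbove (fun _ => ℝ) 0 x) := by
        refine lintegral_congr fun x => ?_
        simp only [Fin.sum_univ_succ]
        rfl
    _ = ∫⁻ y : Fin n → ℝ, ∫⁻ t : ℝ, G (t, y) := by
        rw [(volume_preserving_piFinSuccAbove (fun _ : Fin (n + 1) => ℝ) 0).lintegral_comp hG,
          Measure.volume_eq_prod, lintegral_prod_symm _ hG.aemeasurable]
    _ = _ := by
        refine lintegral_congr fun y => ?_
        by_cases hy : y ∈ s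
        · have : ∀ t : ℝ, G (t, y) = ENNReal.ofReal (if t ^ 2 + ∑ j, y j ^ 2 < 1 then
              K * (1 - (t ^ 2 + ∑ j, y j ^ 2)) ^ (ν / 2 - 1) else 0) :=
            fun t => Set.indicator_of_mem (s := Prod.snd ⁻¹' s) hy _
          simp_rw [this]
          rw [lintegral_one_sub_sq_add K ν _ hK hν, hC, Set.indicator_of_mem hy]
        · have : ∀ t : ℝ, G (t, y) = 0 :=
            fun t => Set.indicator_of_notMem (s := Prod.snd ⁻¹' s) hy _
          simp [this, Set.indicator_of_notMem hy]

/-- The squared norm of a beta type I vector has a beta distribution. -/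
lemma map_sum_sq_betaIRowMeasure (n : ℕ) (ν : ℝ) (hν : 0 < ν) :
    Measure.map (fun x : Fin (n + 1) → ℝ => ∑ j, x j ^ 2) (betaIRowMeasure (n + 1) ν) =
      betaMeas (((n + 1 : ℕ) : ℝ) / 2) (ν / 2) := by
  have hm := measurable_sum_sq (n + 1)
  have hK := betaIRow_const_nonneg (n + 1) ν hν
  have hd := measurable_betaIRow_density
    (π ^ (-((n + 1 : ℕ) : ℝ) / 2) * (Gamma ((ν + (n + 1 : ℕ)) / 2) / Gamma (ν / 2))) (ν / 2 - 1)
  have hp : (0 : ℝ) < ((n + 1 : ℕ) : ℝ) / 2 := by positivity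
  have hg := Real.Gamma_pos_of_pos hp
  ext s hs
  rw [Measure.map_apply hm hs, betaIRowMeasure, betaMeas, withDensity_apply _ (hm hs),
    withDensity_apply _ hs, ← lintegral_indicator (hm hs), ← lintegral_indicator hs]
  refine (lintegral_sum_sq n _ (hd.indicator hs)).trans ?_
  rw [← lintegral_indicator measurableSet_Ioi]
  refine lintegral_congr fun u => ?_
  by_cases hus : u ∈ s
  swap
  · simp [hus]
  by_cases hu : 0 < u
  swap
  · simp [hu, hus]
  rw [Set.indicator_of_mem (Set.mem_Ioi.2 hu), Set.indicator_of_mem hus, Set.indicator_of_mem hus]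
  by_cases hu1 : u < 1
  swap
  · simp [hu1]
  rw [if_pos hu1, if_pos ⟨hu, hu1⟩, ← ENNReal.ofReal_mul (by positivity),
    ← ENNReal.ofReal_mul (by positivity), neg_div, Real.rpow_neg Real.pi_pos.le,
    show (ν + (n + 1 : ℕ)) / 2 = ((n + 1 : ℕ) : ℝ) / 2 + ν / 2 by ring]
  congr 1
  have h0 : π ^ (((n + 1 : ℕ) : ℝ) / 2) ≠ 0 := by positivity
  have h1 := (Real.Gamma_pos_of_pos (half_pos hν)).ne'
  field_simp

instance (N : ℕ) (ν : ℝ) : SigmaFinite (betaIRowMeasure N ν) :=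
  SigmaFinite.withDensity_ofReal _

instance (a b : ℝ) : SigmaFinite (betaMeas a b) :=
  SigmaFinite.withDensity_ofReal _

lemma measurable_det_sq (n : ℕ) :
    Measurable fun M : Fin n → Fin n → ℝ => (Matrix.of M).det ^ 2 := by
  simp only [Matrix.det_apply, Matrix.of_apply]
  fun_prop

lemma measurePreserving_tail_mulVec_pi (n : ℕ) (ν : Fin n → ℝ) (hν : ∀ l, 0 < ν l)
    (U : Matrix (Fin (n + 1)) (Fin (n + 1)) ℝ) (hU : U * U.transpose = 1) :
    MeasurePreserving (fun (Y : Fin n → Fin (n + 1) → ℝ) i => Fin.tail (U.mulVec (Y i)))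
      (Measure.pi fun l => betaIRowMeasure (n + 1) (ν l))
      (Measure.pi fun l => betaIRowMeasure n (ν l + 1)) := by
  have hm : Measurable (Fin.tail : (Fin (n + 1) → ℝ) → Fin n → ℝ) :=
    measurable_pi_lambda _ fun i => measurable_pi_apply _
  exact measurePreserving_pi (fun l => betaIRowMeasure (n + 1) (ν l))
    (fun l => betaIRowMeasure n (ν l + 1)) fun l =>
      MeasurePreserving.comp ⟨hm, map_tail_betaIRowMeasure n (ν l) (hν l)⟩
        (measurePreserving_mulVec_betaIRowMeasure (n + 1) (ν l) U hU)

/-- Conditioning on the first row: rotating it onto an axis splits off its squared norm. -/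
lemma map_det_sq_pi_succ (n : ℕ) (ν : Fin (n + 1) → ℝ) (hν : ∀ l, 0 < ν l) :
    Measure.map (fun M : Fin (n + 1) → Fin (n + 1) → ℝ => (Matrix.of M).det ^ 2)
        (Measure.pi fun l => betaIRowMeasure (n + 1) (ν l)) =
      Measure.map (fun p : ℝ × ℝ => p.1 * p.2)
        ((betaMeas (((n + 1 : ℕ) : ℝ) / 2) (ν 0 / 2)).prod
          (Measure.map (fun M : Fin n → Fin n → ℝ => (Matrix.of M).det ^ 2)
            (Measure.pi fun l => betaIRowMeasure n (ν l.succ + 1)))) := by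
  have hD := measurable_det_sq (n + 1)
  have hd := measurable_det_sq n
  have hmul : Measurable fun p : ℝ × ℝ => p.1 * p.2 := by fun_prop
  refine Measure.ext_of_lintegral _ fun f hf => ?_
  have hinner : Measurable fun b : ℝ => ∫⁻ w, f (b * w)
      ∂(Measure.map (fun M : Fin n → Fin n → ℝ => (Matrix.of M).det ^ 2)
        (Measure.pi fun l => betaIRowMeasure n (ν l.succ + 1))) :=
    Measurable.lintegral_prod_right' (f := fun p : ℝ × ℝ => f (p.1 * p.2)) (hf.comp hmul)
  rw [lintegral_map hf hD, lintegral_map hf hmul,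
    lintegral_prod (fun p : ℝ × ℝ => f (p.1 * p.2)) (hf.comp hmul).aemeasurable,
    ← map_sum_sq_betaIRowMeasure n (ν 0) (hν 0), lintegral_map hinner (measurable_sum_sq _)]
  let e := MeasurableEquiv.piFinSuccAbove (fun _ : Fin (n + 1) => Fin (n + 1) → ℝ) 0
  have he : MeasurePreserving e (Measure.pi fun l => betaIRowMeasure (n + 1) (ν l)) _ :=
    measurePreserving_piFinSuccAbove (fun l => betaIRowMeasure (n + 1) (ν l)) 0
  rw [← he.symm.lintegral_comp_emb e.symm.measurableEmbedding,
    lintegral_prod (fun p => f ((Matrix.of (e.symm p)).det ^ 2))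
      ((hf.comp hD).comp e.symm.measurable).aemeasurable]
  refine lintegral_congr fun x => ?_
  obtain ⟨U, hU, hUx⟩ := exists_orthogonal_mulVec_eq_single n x
  have hT := measurePreserving_tail_mulVec_pi n (fun l => ν l.succ) (fun l => hν _) U hU
  rw [lintegral_map (f := fun w => f ((∑ j, x j ^ 2) * w)) (hf.comp (measurable_const_mul _)) hd,
    ← hT.lintegral_comp]
  · refine lintegral_congr fun Y => ?_
    have := det_cons_sq_of_orthogonal n x Y U hU _ hUx
    rw [Real.sq_sqrt (by positivity)] at this
    rw [← this, show e.symm (x, Y) = Fin.cons x Y from Fin.insertNth_zero' x Y]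
  · exact hf.comp (hd.const_mul _)

lemma map_prod_pi_succ (n : ℕ) (μ : Fin (n + 1) → Measure ℝ) [∀ l, SigmaFinite (μ l)] :
    Measure.map (fun z : Fin (n + 1) → ℝ => ∏ l, z l) (Measure.pi μ) =
      Measure.map (fun p : ℝ × ℝ => p.1 * p.2)
        ((μ 0).prod (Measure.map (fun z : Fin n → ℝ => ∏ l, z l)
          (Measure.pi fun l => μ l.succ))) := by
  have hmul : Measurable fun p : ℝ × ℝ => p.1 * p.2 := by fun_prop
  have hp : Measurable fun z : Fin n → ℝ => ∏ l, z l := by fun_prop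
  have he := measurePreserving_piFinSuccAbove μ 0
  have h2 := Measure.map_prod_map (μ 0) (Measure.pi fun l => μ l.succ) measurable_id hp
  rw [Measure.map_id] at h2
  rw [h2, Measure.map_map hmul (by fun_prop),
    show (Measure.pi fun l : Fin n => μ l.succ) =
      Measure.pi fun l => μ (Fin.succAbove 0 l) from rfl,
    ← he.map_eq, Measure.map_map (by fun_prop) (MeasurableEquiv.measurable _)]
  congr 1
  ext z
  rw [Fin.prod_univ_succ]
  rfl

theorem statement3 (N : ℕ) (hN : 0 < N) (ν : Fin N → ℝ) (hν : ∀ l, 0 < ν l) :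
    Measure.map (fun M : Fin N → Fin N → ℝ => Matrix.det (Matrix.of M) ^ 2)
        (Measure.pi fun l => betaIRowMeasure N (ν l)) =
      Measure.map (fun z : Fin N → ℝ => ∏ l, z l)
        (Measure.pi fun l : Fin N =>
          betaMeas (((N : ℝ) - (l : ℕ)) / 2) ((ν l + (l : ℕ)) / 2)) := by
  clear hN
  induction N with
  | zero =>
    simp only [Matrix.det_isEmpty, one_pow, Finset.univ_eq_empty, Finset.prod_empty]
    rw [Measure.pi_of_empty, Measure.pi_of_empty, Measure.map_dirac' measurable_const,
      Measure.map_dirac' measurable_const]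
  | succ n ih =>
    rw [map_det_sq_pi_succ n ν hν, map_prod_pi_succ,
      ih (fun l => ν l.succ + 1) fun l => add_pos (hν _) one_pos]
    congr 2
    · simp
    · congr 2
      ext1 l
      congr 2 <;> (push_cast [Fin.val_succ]; ring)
end

section
/- Let N be a positive integer and let ω_1, …, ω_N > 0. Let X be a random N×N real matrix whose rows are independent, with row l distributed according to the beta type II density π^{-N/2} (Γ((ω_l+N)/2)/Γ(ω_l/2)) (1+|x|²)^{-(N+ω_l)/2} on ℝ^N. Then for every real α with −1/2 < α < min_{1≤l≤N} ω_l/2, the expectation E[|det X|^{2α}] is finite and equals ∏_{l=1}^N [Γ((N−l+1)/2 + α)/Γ((N−l+1)/2)] · [Γ(ω_l/2 − α)/Γ(ω_l/2)]. -/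
open MeasureTheory Real

/-- The distribution on `ℝ^N` of a row with beta type II density
`π^{-N/2} (Γ((ω+N)/2)/Γ(ω/2)) (1+|x|²)^{-(N+ω)/2}` on `ℝ^N`. -/
noncomputable def betaIIRowMeasure (N : ℕ) (ω : ℝ) : Measure (Fin N → ℝ) :=
  volume.withDensity fun x =>
    ENNReal.ofReal (π ^ (-(N : ℝ) / 2) * (Real.Gamma ((ω + N) / 2) / Real.Gamma (ω / 2)) *
      (1 + ∑ j, x j ^ 2) ^ (-((N : ℝ) + ω) / 2))

theorem lintegral_rpow_mul_exp_neg_mul_rpow {p q b : ℝ} (hp : 0 < p) (hq : -1 < q) (hb : 0 < b) :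
    ∫⁻ x in Set.Ioi (0 : ℝ), ENNReal.ofReal (x ^ q * exp (-b * x ^ p)) =
      ENNReal.ofReal (b ^ (-(q + 1) / p) * (1 / p) * Gamma ((q + 1) / p)) := by
  rw [← integral_rpow_mul_exp_neg_mul_rpow hp hq hb,
    ofReal_integral_eq_lintegral_ofReal (integrableOn_rpow_mul_exp_neg_mul_rpow hq hp hb)]
  filter_upwards [ae_restrict_mem measurableSet_Ioi] with x hx
  have : (0 : ℝ) < x := hx
  positivity

theorem lintegral_rpow_mul_add_sq_rpow {A q s : ℝ} (hA : 0 < A) (hq : -1 < q)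
    (hs : q + 1 < 2 * s) :
    ∫⁻ y in Set.Ioi (0 : ℝ), ENNReal.ofReal (y ^ q * (A + y ^ 2) ^ (-s)) =
      ENNReal.ofReal (A ^ ((q + 1) / 2 - s) *
        (Gamma ((q + 1) / 2) * Gamma (s - (q + 1) / 2) / (2 * Gamma s))) := by
  have hs0 : 0 < s := by linarith
  have hG : 0 < Gamma s := Gamma_pos_of_pos hs0
  have hG1 : 0 < Gamma ((q + 1) / 2) := Gamma_pos_of_pos (by linarith)
  have hG2 : 0 < Gamma (s - (q + 1) / 2) := Gamma_pos_of_pos (by linarith)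
  have mixture : ∀ y ∈ Set.Ioi (0 : ℝ), ENNReal.ofReal (y ^ q * (A + y ^ 2) ^ (-s)) =
      ENNReal.ofReal (Gamma s)⁻¹ * ∫⁻ t in Set.Ioi (0 : ℝ),
        ENNReal.ofReal (t ^ (s - 1) * exp (-A * t) * (y ^ q * exp (-t * y ^ (2 : ℝ)))) := by
    intro y hy
    have hy0 : (0 : ℝ) < y := hy
    have hAy : 0 < A + y ^ 2 := by positivity
    have h := lintegral_rpow_mul_exp_neg_mul_rpow (p := 1) (q := s - 1) one_pos (by linarith) hAy
    have e : ∀ t : ℝ, ENNReal.ofReal (t ^ (s - 1) * exp (-A * t) * (y ^ q * exp (-t * y ^ (2 : ℝ))))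
        = ENNReal.ofReal (y ^ q) *
          ENNReal.ofReal (t ^ (s - 1) * exp (-(A + y ^ 2) * t ^ (1 : ℝ))) := by
      intro t
      rw [← ENNReal.ofReal_mul (by positivity), rpow_one, rpow_two]
      congr 1
      rw [show -(A + y ^ 2) * t = -A * t + -t * y ^ 2 by ring, exp_add]
      ring
    simp_rw [e]
    rw [lintegral_const_mul _ (by fun_prop), h, ← ENNReal.ofReal_mul (by positivity),
      ← ENNReal.ofReal_mul (by positivity)]
    congr 1
    simp only [sub_add_cancel, div_one]
    field_simp
  rw [setLIntegral_congr_fun measurableSet_Ioi mixture, lintegral_const_mul' _ _ (by simp),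
    lintegral_lintegral_swap (by fun_prop)]
  have inner : ∀ t ∈ Set.Ioi (0 : ℝ), ∫⁻ y in Set.Ioi (0 : ℝ),
        ENNReal.ofReal (t ^ (s - 1) * exp (-A * t) * (y ^ q * exp (-t * y ^ (2 : ℝ)))) =
      ENNReal.ofReal (1 / 2 * Gamma ((q + 1) / 2)) *
        ENNReal.ofReal (t ^ (s - (q + 1) / 2 - 1) * exp (-A * t ^ (1 : ℝ))) := by
    intro t ht
    have ht0 : (0 : ℝ) < t := ht
    simp_rw [ENNReal.ofReal_mul (show 0 ≤ t ^ (s - 1) * exp (-A * t) by positivity)]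
    rw [lintegral_const_mul' _ _ (by simp), lintegral_rpow_mul_exp_neg_mul_rpow two_pos hq ht0,
      ← ENNReal.ofReal_mul (by positivity), ← ENNReal.ofReal_mul (by positivity), rpow_one,
      show s - (q + 1) / 2 - 1 = (s - 1) + -(q + 1) / 2 by ring, rpow_add ht0]
    congr 1
    ring
  rw [setLIntegral_congr_fun measurableSet_Ioi inner, lintegral_const_mul' _ _ ENNReal.ofReal_ne_top,
    lintegral_rpow_mul_exp_neg_mul_rpow one_pos (by linarith) hA,
    ← ENNReal.ofReal_mul (by positivity), ← ENNReal.ofReal_mul (by positivity)]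
  congr 1
  simp only [sub_add_cancel, div_one, neg_sub]
  field_simp

theorem integrableOn_rpow_mul_add_sq_rpow {A q s : ℝ} (hA : 0 < A) (hq : -1 < q)
    (hs : q + 1 < 2 * s) :
    IntegrableOn (fun y : ℝ => y ^ q * (A + y ^ 2) ^ (-s)) (Set.Ioi 0) := by
  refine ⟨by fun_prop, ?_⟩
  rw [hasFiniteIntegral_iff_ofReal, lintegral_rpow_mul_add_sq_rpow hA hq hs]
  · exact ENNReal.ofReal_lt_top
  filter_upwards [ae_restrict_mem measurableSet_Ioi] with x hx
  have : (0 : ℝ) < x := hx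
  positivity

theorem integral_rpow_mul_add_sq_rpow {A q s : ℝ} (hA : 0 < A) (hq : -1 < q)
    (hs : q + 1 < 2 * s) :
    ∫ y in Set.Ioi (0 : ℝ), y ^ q * (A + y ^ 2) ^ (-s) =
      A ^ ((q + 1) / 2 - s) *
        (Gamma ((q + 1) / 2) * Gamma (s - (q + 1) / 2) / (2 * Gamma s)) := by
  rw [integral_eq_lintegral_of_nonneg_ae _ (by fun_prop), lintegral_rpow_mul_add_sq_rpow hA hq hs,
    ENNReal.toReal_ofReal]
  · have hG : 0 < Gamma s := Gamma_pos_of_pos (by linarith)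
    have hG1 : 0 < Gamma ((q + 1) / 2) := Gamma_pos_of_pos (by linarith)
    have hG2 : 0 < Gamma (s - (q + 1) / 2) := Gamma_pos_of_pos (by linarith)
    positivity
  filter_upwards [ae_restrict_mem measurableSet_Ioi] with x hx
  have : (0 : ℝ) < x := hx
  positivity

theorem lintegral_add_sq_rpow {A s : ℝ} (hA : 0 < A) (hs : 1 < 2 * s) :
    ∫⁻ y : ℝ, ENNReal.ofReal ((A + y ^ 2) ^ (-s)) =
      ENNReal.ofReal (A ^ (1 / 2 - s) * (√π * Gamma (s - 1 / 2) / Gamma s)) := by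
  have h := integrableOn_rpow_mul_add_sq_rpow hA neg_one_lt_zero (s := s) (by linarith)
  have h' := integral_rpow_mul_add_sq_rpow hA neg_one_lt_zero (s := s) (by linarith)
  simp only [rpow_zero, one_mul, zero_add, Gamma_one_half_eq] at h h'
  have e : (fun y : ℝ => (A + y ^ 2) ^ (-s)) = fun y => (fun z => (A + z ^ 2) ^ (-s)) |y| := by
    simp
  rw [← ofReal_integral_eq_lintegral_ofReal, e,
    integral_comp_abs (f := fun z => (A + z ^ 2) ^ (-s)), h']
  · congr 1
    field_simp
  · rw [e]
    refine (integrable_fun_norm_addHaar volume (f := fun z : ℝ => (A + z ^ 2) ^ (-s))).2 ?_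
    simpa using h
  · filter_upwards with y
    positivity

/-- The Householder reflection mapping `x` to a multiple of the first basis vector. -/
theorem exists_transpose_mul_self_eq_one_mulVec_eq_single {n : ℕ} (x : Fin (n + 1) → ℝ) :
    ∃ A : Matrix (Fin (n + 1)) (Fin (n + 1)) ℝ,
      A.transpose * A = 1 ∧ A.mulVec x = Pi.single 0 √(∑ j, x j ^ 2) := by
  set r := √(∑ j, x j ^ 2) with hr
  have hxx : x ⬝ᵥ x = r ^ 2 := by
    rw [hr, sq_sqrt (by positivity)]
    simp [dotProduct, sq]
  set e : Fin (n + 1) → ℝ := Pi.single 0 r with he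
  set v := x - e with hv
  have hvx : 2 * (v ⬝ᵥ x) = v ⬝ᵥ v := by
    simp only [hv, he, sub_dotProduct, dotProduct_sub, single_dotProduct, dotProduct_single,
      Pi.sub_apply, Pi.single_eq_same, hxx]
    ring
  have hc : v = 0 ∨ v ⬝ᵥ v ≠ 0 := by
    by_cases h : v = 0
    · exact Or.inl h
    · exact Or.inr (by simpa [dotProduct_self_eq_zero] using h)
  rcases hc with h | h
  · exact ⟨1, by simp, by simpa [hv, sub_eq_zero] using h⟩
  refine ⟨1 - (2 / (v ⬝ᵥ v)) • Matrix.vecMulVec v v, ?_, ?_⟩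
  · simp only [Matrix.transpose_sub, Matrix.transpose_one, Matrix.transpose_smul,
      Matrix.transpose_vecMulVec, Matrix.sub_mul, Matrix.mul_sub, Matrix.one_mul, Matrix.mul_one,
      Matrix.smul_mul, Matrix.mul_smul, Matrix.vecMulVec_mul_vecMulVec]
    ext i j
    simp [Matrix.vecMulVec_apply]
    field_simp
    ring
  · ext i
    simp only [Matrix.sub_mulVec, Matrix.one_mulVec, Matrix.smul_mulVec, Matrix.vecMulVec_mulVec]
    simp
    have : x i - v i = e i := by simp [hv]
    rw [← this, ← hvx]
    rw [← hvx] at h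
    have h' : v ⬝ᵥ x ≠ 0 := by simpa using h
    field_simp

theorem abs_det_eq_one_of_transpose_mul_self {n : ℕ} {A : Matrix (Fin n) (Fin n) ℝ}
    (hA : A.transpose * A = 1) : |A.det| = 1 := by
  have h := congrArg Matrix.det hA
  rw [Matrix.det_mul, Matrix.det_transpose, Matrix.det_one] at h
  exact (abs_eq zero_le_one).2 (mul_self_eq_one_iff.1 h)

theorem measurable_betaIIRow_density (N : ℕ) (ω : ℝ) :
    Measurable fun x : Fin N → ℝ => ENNReal.ofReal
      (π ^ (-(N : ℝ) / 2) * (Real.Gamma ((ω + N) / 2) / Real.Gamma (ω / 2)) *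
        (1 + ∑ j, x j ^ 2) ^ (-((N : ℝ) + ω) / 2)) := by
  fun_prop

theorem lintegral_betaIIRowMeasure (N : ℕ) (ω : ℝ) {f : (Fin N → ℝ) → ENNReal}
    (hf : Measurable f) :
    ∫⁻ x, f x ∂betaIIRowMeasure N ω = ∫⁻ x, ENNReal.ofReal
      (π ^ (-(N : ℝ) / 2) * (Real.Gamma ((ω + N) / 2) / Real.Gamma (ω / 2)) *
        (1 + ∑ j, x j ^ 2) ^ (-((N : ℝ) + ω) / 2)) * f x :=
  lintegral_withDensity_eq_lintegral_mul _ (measurable_betaIIRow_density N ω) hf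

instance sigmaFinite_betaIIRowMeasure (N : ℕ) (ω : ℝ) : SigmaFinite (betaIIRowMeasure N ω) := by
  unfold betaIIRowMeasure
  infer_instance

theorem measurePreserving_mulVec_betaIIRowMeasure {N : ℕ} (ω : ℝ) {A : Matrix (Fin N) (Fin N) ℝ}
    (hA : A.transpose * A = 1) :
    MeasurePreserving A.mulVec (betaIIRowMeasure N ω) (betaIIRowMeasure N ω) := by
  have hdet := abs_det_eq_one_of_transpose_mul_self hA
  have hm : Measurable A.mulVec := by
    unfold Matrix.mulVec dotProduct
    fun_prop
  have hvol : MeasurePreserving A.mulVec := by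
    refine ⟨hm, ?_⟩
    have h0 : A.det ≠ 0 := by
      intro h
      simp [h] at hdet
    have h := Real.map_matrix_volume_pi_eq_smul_volume_pi h0
    rwa [abs_inv, hdet, inv_one, ENNReal.ofReal_one, one_smul] at h
  have hnorm : ∀ x : Fin N → ℝ, ∑ j, A.mulVec x j ^ 2 = ∑ j, x j ^ 2 := by
    intro x
    have : A.mulVec x ⬝ᵥ A.mulVec x = x ⬝ᵥ x := by
      rw [Matrix.dotProduct_mulVec, ← Matrix.mulVec_transpose, Matrix.mulVec_mulVec, hA,
        Matrix.one_mulVec]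
    simpa [dotProduct, sq] using this
  refine ⟨hm, Measure.ext_of_lintegral _ fun f hf => ?_⟩
  rw [lintegral_map hf hm, lintegral_betaIIRowMeasure N ω (f := fun x => f (A.mulVec x)) (hf.comp hm),
    lintegral_betaIIRowMeasure N ω hf,
    ← hvol.lintegral_comp ((measurable_betaIIRow_density N ω).fun_mul hf)]
  simp [hnorm]

theorem piFinSuccAbove_zero_symm_apply {n : ℕ} {β : Type*} [MeasurableSpace β]
    (x : β) (y : Fin n → β) :
    (MeasurableEquiv.piFinSuccAbove (fun _ : Fin (n + 1) => β) 0).symm (x, y) = Fin.cons x y :=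
  Fin.insertNth_zero' x y

theorem measurePreserving_tail_betaIIRowMeasure {N : ℕ} {ω : ℝ} (hω : 0 < ω) :
    MeasurePreserving (fun x : Fin (N + 1) → ℝ => Fin.tail x)
      (betaIIRowMeasure (N + 1) ω) (betaIIRowMeasure N ω) := by
  have hm : Measurable (fun x : Fin (N + 1) → ℝ => (Fin.tail x : Fin N → ℝ)) := by
    unfold Fin.tail
    fun_prop
  refine ⟨hm, Measure.ext_of_lintegral _ fun f hf => ?_⟩
  have hfm : Measurable fun x : Fin (N + 1) → ℝ => f (Fin.tail x) := hf.comp hm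
  have hdm := (measurable_betaIIRow_density (N + 1) ω).fun_mul hfm
  rw [lintegral_map hf hm, lintegral_betaIIRowMeasure (N + 1) ω hfm,
    lintegral_betaIIRowMeasure N ω hf,
    ← (volume_preserving_piFinSuccAbove (fun _ => ℝ) 0).symm.lintegral_comp
      hdm, Measure.volume_eq_prod,
    lintegral_prod_symm' _ (by exact hdm.comp (MeasurableEquiv.measurable _))]
  refine lintegral_congr fun y => ?_
  have hy : 0 < 1 + ∑ j, y j ^ 2 := by positivity
  have hG1 : 0 < Gamma (ω / 2) := Gamma_pos_of_pos (by positivity)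
  have hG2 : 0 < Gamma ((ω + N) / 2) := Gamma_pos_of_pos (by positivity)
  have hG3 : 0 < Gamma ((ω + N + 1) / 2) := Gamma_pos_of_pos (by positivity)
  have h1 := lintegral_add_sq_rpow hy (s := (N + 1 + ω) / 2)
    (by have : (0 : ℝ) ≤ N := N.cast_nonneg
        linarith)
  simp only [piFinSuccAbove_zero_symm_apply, Fin.tail_cons, Fin.sum_univ_succ, Fin.cons_zero,
    Fin.cons_succ]
  rw [lintegral_mul_const _ (by fun_prop)]
  congr 1
  have hC : (0 : ℝ) ≤ π ^ (-((N + 1 : ℕ) : ℝ) / 2) *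
      (Gamma ((ω + (N + 1 : ℕ)) / 2) / Gamma (ω / 2)) := by
    push_cast
    rw [← add_assoc]
    positivity
  simp_rw [ENNReal.ofReal_mul hC]
  rw [lintegral_const_mul _ (by fun_prop)]
  have e : ∀ t : ℝ, (1 + (t ^ 2 + ∑ j, y j ^ 2)) ^ (-(((N + 1 : ℕ) : ℝ) + ω) / 2) =
      (1 + ∑ j, y j ^ 2 + t ^ 2) ^ (-((N + 1 + ω) / 2)) := by
    intro t
    push_cast
    congr 1 <;> ring
  simp_rw [e]
  rw [h1, ← ENNReal.ofReal_mul hC]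
  congr 1
  push_cast
  rw [show (1 : ℝ) / 2 - (N + 1 + ω) / 2 = -(N + ω) / 2 by ring,
    show ((N : ℝ) + 1 + ω) / 2 - 1 / 2 = (ω + N) / 2 by ring,
    show ((N : ℝ) + 1 + ω) / 2 = (ω + N + 1) / 2 by ring, ← add_assoc,
    show -((N : ℝ) + 1) / 2 = -N / 2 - 1 / 2 by ring, rpow_sub pi_pos, ← sqrt_eq_rpow]
  have := sqrt_pos.2 pi_pos
  field_simp

theorem lintegral_sqrt_sum_sq_rpow_betaIIRowMeasure {N : ℕ} {ω α : ℝ} (hω : 0 < ω)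
    (hα₁ : -(1 / 2 : ℝ) < α) (hα₂ : α < ω / 2) :
    ∫⁻ x, ENNReal.ofReal (√(∑ j, x j ^ 2) ^ (2 * α)) ∂betaIIRowMeasure (N + 1) ω =
      ENNReal.ofReal ((Gamma (((N : ℝ) + 1) / 2 + α) / Gamma (((N : ℝ) + 1) / 2)) *
        (Gamma (ω / 2 - α) / Gamma (ω / 2))) := by
  have hN0 : (0 : ℝ) ≤ N := N.cast_nonneg
  have hG1 : 0 < Gamma (ω / 2) := Gamma_pos_of_pos (by positivity)
  have hG2 : 0 < Gamma ((ω + N + 1) / 2) := Gamma_pos_of_pos (by positivity)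
  have hG3 : 0 < Gamma (((N : ℝ) + 1) / 2) := Gamma_pos_of_pos (by positivity)
  have hm : Measurable fun x : Fin (N + 1) → ℝ =>
    ENNReal.ofReal (√(∑ j, x j ^ 2) ^ (2 * α)) := by fun_prop
  set C : ℝ := π ^ (-((N + 1 : ℕ) : ℝ) / 2) *
      (Gamma ((ω + (N + 1 : ℕ)) / 2) / Gamma (ω / 2)) with hC
  have hC0 : 0 ≤ C := by
    rw [hC]
    push_cast
    rw [← add_assoc]
    positivity
  rw [lintegral_betaIIRowMeasure (N + 1) ω hm,
    ← (PiLp.volume_preserving_ofLp (Fin (N + 1))).lintegral_comp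
      ((measurable_betaIIRow_density (N + 1) ω).fun_mul hm)]
  set g : ℝ → ℝ := fun r => r ^ (2 * α) * (1 + r ^ 2) ^ (-((N + 1 + ω) / 2)) with hg
  have e : ∀ x : EuclideanSpace ℝ (Fin (N + 1)),
      ENNReal.ofReal (C * (1 + ∑ j, x j ^ 2) ^ (-(((N + 1 : ℕ) : ℝ) + ω) / 2)) *
          ENNReal.ofReal (√(∑ j, x j ^ 2) ^ (2 * α)) =
      ENNReal.ofReal C * ENNReal.ofReal (g ‖x‖) := by
    intro x
    have hx : ∑ j, x j ^ 2 = ‖x‖ ^ 2 := by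
      rw [EuclideanSpace.norm_sq_eq]
      simp
    simp only [hx, sqrt_sq (norm_nonneg x), hg]
    rw [← ENNReal.ofReal_mul (by positivity), ← ENNReal.ofReal_mul hC0]
    congr 1
    push_cast
    rw [neg_div]
    ring
  refine (lintegral_congr e).trans ?_
  have hq : -1 < (N : ℝ) + 2 * α := by linarith
  have hs : (N : ℝ) + 2 * α + 1 < 2 * ((N + 1 + ω) / 2) := by linarith
  have hgy : Set.EqOn (fun y : ℝ => y ^ N • g y)
      (fun y => y ^ ((N : ℝ) + 2 * α) * (1 + y ^ 2) ^ (-(((N : ℝ) + 1 + ω) / 2))) (Set.Ioi 0) := by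
    intro y hy
    have hy0 : (0 : ℝ) < y := hy
    simp only [hg, smul_eq_mul, rpow_add hy0, rpow_natCast]
    ring
  have hgi : Integrable (fun x : EuclideanSpace ℝ (Fin (N + 1)) => g ‖x‖) := by
    refine (integrable_fun_norm_addHaar volume).2 ?_
    simp only [finrank_euclideanSpace, Fintype.card_fin, Nat.add_sub_cancel]
    rw [integrableOn_congr_fun hgy measurableSet_Ioi]
    exact integrableOn_rpow_mul_add_sq_rpow one_pos hq hs
  rw [lintegral_const_mul' _ _ ENNReal.ofReal_ne_top,
    ← ofReal_integral_eq_lintegral_ofReal hgi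
      (Filter.Eventually.of_forall fun x => by simp only [hg]; positivity),
    ← ENNReal.ofReal_mul hC0, integral_fun_norm_addHaar volume g]
  congr 1
  simp only [finrank_euclideanSpace, Fintype.card_fin, Nat.add_sub_cancel]
  rw [setIntegral_congr_fun measurableSet_Ioi hgy, integral_rpow_mul_add_sq_rpow one_pos hq hs,
    Measure.real, EuclideanSpace.volume_ball]
  simp only [Fintype.card_fin, ENNReal.ofReal_one, one_pow, one_mul, one_rpow, nsmul_eq_mul,
    smul_eq_mul]
  rw [hC]
  push_cast
  rw [Gamma_add_one (by positivity), ENNReal.toReal_ofReal (by positivity),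
    show ((N : ℝ) + 1 + ω) / 2 - (N + 2 * α + 1) / 2 = ω / 2 - α by ring,
    show ((N : ℝ) + 2 * α + 1) / 2 = (N + 1) / 2 + α by ring,
    show ((N : ℝ) + 1 + ω) / 2 = (ω + N + 1) / 2 by ring, ← add_assoc,
    show -((N : ℝ) + 1) / 2 = -((1 / 2) * (N + 1 : ℕ)) by push_cast; ring, rpow_neg pi_pos.le,
    rpow_mul pi_pos.le, ← sqrt_eq_rpow, rpow_natCast]
  have := sqrt_pos.2 pi_pos
  field_simp

theorem abs_det_cons_eq {n : ℕ} {A : Matrix (Fin (n + 1)) (Fin (n + 1)) ℝ}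
    (hA : A.transpose * A = 1) {x : Fin (n + 1) → ℝ} {r : ℝ} (hr : 0 ≤ r)
    (hx : A.mulVec x = Pi.single 0 r) (M : Fin n → Fin (n + 1) → ℝ) :
    |(Matrix.of (Fin.cons x M : Fin (n + 1) → Fin (n + 1) → ℝ)).det| =
      r * |(Matrix.of fun i => Fin.tail (A.mulVec (M i))).det| := by
  have h1 : |(Matrix.of (Fin.cons x M : Fin (n + 1) → Fin (n + 1) → ℝ)).det| =
      |(Matrix.of (Fin.cons x M : Fin (n + 1) → Fin (n + 1) → ℝ) * A.transpose).det| := by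
    rw [Matrix.det_mul, Matrix.det_transpose, abs_mul, abs_det_eq_one_of_transpose_mul_self hA,
      mul_one]
  have h2 : Matrix.of (Fin.cons x M : Fin (n + 1) → Fin (n + 1) → ℝ) * A.transpose =
      Matrix.of (Fin.cons (Pi.single 0 r) fun i => A.mulVec (M i)) := by
    ext i j
    refine Fin.cases ?_ (fun i => ?_) i
    · simp [← hx, Matrix.mul_apply, Matrix.mulVec, dotProduct, mul_comm]
    · simp [Matrix.mul_apply, Matrix.mulVec, dotProduct, mul_comm]
  rw [h1, h2, Matrix.det_succ_row_zero, Fin.sum_univ_succ]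
  simp [abs_mul, abs_of_nonneg hr]
  left
  congr 2

theorem measurable_ofReal_abs_det_rpow (n : ℕ) (β : ℝ) :
    Measurable fun M : Fin n → Fin n → ℝ => ENNReal.ofReal (|(Matrix.of M).det| ^ β) := by
  simp only [Matrix.det_apply, Matrix.of_apply]
  fun_prop

theorem prod_Gamma_div_nonneg {N : ℕ} {ω : Fin N → ℝ} (hω : ∀ l, 0 < ω l) {α : ℝ}
    (hα₁ : -(1 / 2 : ℝ) < α) (hα₂ : ∀ l, α < ω l / 2) :
    0 ≤ ∏ l : Fin N,
      (Gamma (((N : ℝ) - (l : ℕ)) / 2 + α) / Gamma (((N : ℝ) - (l : ℕ)) / 2)) *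
        (Gamma (ω l / 2 - α) / Gamma (ω l / 2)) := by
  refine Finset.prod_nonneg fun l _ => ?_
  have hl : (l : ℝ) + 1 ≤ N := by exact_mod_cast l.2
  have h1 := Gamma_pos_of_pos (s := ((N : ℝ) - (l : ℕ)) / 2 + α) (by linarith)
  have h2 := Gamma_pos_of_pos (s := ((N : ℝ) - (l : ℕ)) / 2) (by linarith)
  have h3 := Gamma_pos_of_pos (s := ω l / 2 - α) (by linarith [hα₂ l])
  have h4 := Gamma_pos_of_pos (s := ω l / 2) (by linarith [hω l])
  positivity

theorem lintegral_abs_det_rpow_betaII (N : ℕ) (ω : Fin N → ℝ) (hω : ∀ l, 0 < ω l)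
    (α : ℝ) (hα₁ : -(1 / 2 : ℝ) < α) (hα₂ : ∀ l, α < ω l / 2) :
    ∫⁻ M : Fin N → Fin N → ℝ, ENNReal.ofReal (|Matrix.det (Matrix.of M)| ^ (2 * α))
        ∂(Measure.pi fun l => betaIIRowMeasure N (ω l)) =
      ENNReal.ofReal (∏ l : Fin N,
        (Real.Gamma (((N : ℝ) - (l : ℕ)) / 2 + α) / Real.Gamma (((N : ℝ) - (l : ℕ)) / 2)) *
          (Real.Gamma (ω l / 2 - α) / Real.Gamma (ω l / 2))) := by
  induction N with
  | zero => simp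
  | succ N ih =>
    set P : ℝ := ∏ l : Fin N,
        (Real.Gamma (((N : ℝ) - (l : ℕ)) / 2 + α) / Real.Gamma (((N : ℝ) - (l : ℕ)) / 2)) *
          (Real.Gamma (ω l.succ / 2 - α) / Real.Gamma (ω l.succ / 2)) with hP
    have hmeas := measurable_ofReal_abs_det_rpow (N + 1) (2 * α)
    have hinner : ∀ x : Fin (N + 1) → ℝ,
        ∫⁻ M : Fin N → Fin (N + 1) → ℝ, ENNReal.ofReal
          (|(Matrix.of (Fin.cons x M : Fin (N + 1) → Fin (N + 1) → ℝ)).det| ^ (2 * α))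
            ∂(Measure.pi fun l : Fin N => betaIIRowMeasure (N + 1) (ω l.succ)) =
        ENNReal.ofReal (√(∑ j, x j ^ 2) ^ (2 * α)) * ENNReal.ofReal P := by
      intro x
      obtain ⟨A, hA, hAx⟩ := exists_transpose_mul_self_eq_one_mulVec_eq_single x
      have hpres : MeasurePreserving
          (fun (M : Fin N → Fin (N + 1) → ℝ) i => (Fin.tail (A.mulVec (M i)) : Fin N → ℝ))
          (Measure.pi fun l : Fin N => betaIIRowMeasure (N + 1) (ω l.succ))
          (Measure.pi fun l : Fin N => betaIIRowMeasure N (ω l.succ)) :=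
        measurePreserving_pi _ _ (f := fun _ y => Fin.tail (A.mulVec y)) fun l =>
          (measurePreserving_tail_betaIIRowMeasure (hω l.succ)).comp
            (measurePreserving_mulVec_betaIIRowMeasure (ω l.succ) hA)
      rw [← ih (fun l => ω l.succ) (fun l => hω _) (fun l => hα₂ _),
        ← hpres.lintegral_comp (measurable_ofReal_abs_det_rpow N (2 * α)),
        ← lintegral_const_mul' _ _ ENNReal.ofReal_ne_top]
      refine lintegral_congr fun M => ?_
      rw [abs_det_cons_eq hA (sqrt_nonneg _) hAx, mul_rpow (sqrt_nonneg _) (abs_nonneg _),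
        ENNReal.ofReal_mul (by positivity)]
    have hsplit := measurePreserving_piFinSuccAbove
      (fun l : Fin (N + 1) => betaIIRowMeasure (N + 1) (ω l)) 0
    rw [← hsplit.symm.lintegral_comp hmeas,
      lintegral_prod _ (by exact (hmeas.comp (MeasurableEquiv.measurable _)).aemeasurable)]
    simp only [piFinSuccAbove_zero_symm_apply, Fin.zero_succAbove, hinner]
    rw [lintegral_mul_const' _ _ ENNReal.ofReal_ne_top,
      lintegral_sqrt_sum_sq_rpow_betaIIRowMeasure (hω 0) hα₁ (hα₂ 0), ← ENNReal.ofReal_mul',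
      Fin.prod_univ_succ]
    · congr 1
      simp [hP]
    · exact prod_Gamma_div_nonneg (fun l => hω l.succ) hα₁ (fun l => hα₂ l.succ)

theorem statement4 (N : ℕ) (hN : 0 < N) (ω : Fin N → ℝ) (hω : ∀ l, 0 < ω l)
    (α : ℝ) (hα₁ : -(1 / 2 : ℝ) < α) (hα₂ : ∀ l, α < ω l / 2) :
    Integrable (fun M : Fin N → Fin N → ℝ => |Matrix.det (Matrix.of M)| ^ (2 * α))
      (Measure.pi fun l => betaIIRowMeasure N (ω l)) ∧
    ∫ M : Fin N → Fin N → ℝ, |Matrix.det (Matrix.of M)| ^ (2 * α)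
        ∂(Measure.pi fun l => betaIIRowMeasure N (ω l)) =
      ∏ l : Fin N,
        (Real.Gamma (((N : ℝ) - (l : ℕ)) / 2 + α) / Real.Gamma (((N : ℝ) - (l : ℕ)) / 2)) *
          (Real.Gamma (ω l / 2 - α) / Real.Gamma (ω l / 2)) := by
  have h := lintegral_abs_det_rpow_betaII N ω hω α hα₁ hα₂
  have hm : Measurable fun M : Fin N → Fin N → ℝ => |Matrix.det (Matrix.of M)| ^ (2 * α) := by
    simp only [Matrix.det_apply, Matrix.of_apply]
    fun_prop
  have hnn : 0 ≤ᵐ[Measure.pi fun l => betaIIRowMeasure N (ω l)]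
      fun M : Fin N → Fin N → ℝ => |Matrix.det (Matrix.of M)| ^ (2 * α) :=
    Filter.Eventually.of_forall fun M => by positivity
  refine ⟨⟨hm.aestronglyMeasurable, ?_⟩, ?_⟩
  · rw [hasFiniteIntegral_iff_ofReal hnn, h]
    exact ENNReal.ofReal_lt_top
  · rw [integral_eq_lintegral_of_nonneg_ae hnn hm.aestronglyMeasurable, h, ENNReal.toReal_ofReal]
    exact prod_Gamma_div_nonneg hω hα₁ hα₂
end
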